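/- arXiv:1408.0974 — 4 statements merged into one kernel-verified Lean document; each statement's English description precedes it below -/
import Mathlib

section
/- (Theorem 2.1, part 1) Assume hypotheses (H₀). Then the averaged sequence ẑ_n = (1/τ_n) ∑_{k=1}^n λ_k x_{k+1}, where τ_n = ∑_{k=1}^n λ_k, converges weakly to a point of S as n → ∞. -/
open Filter Topology
open scoped RealInnerProductSpace

variable {H : Type*} [NormedAddCommGroup H] [InnerProductSpace ℝ H] [CompleteSpace H]

/-- A set-valued operator `A : H → Set H` is monotone. -/
def MonotoneOp (A : H → Set H) : Prop :=
  ∀ x y x' y', x' ∈ A x → y' ∈ A y → 0 ≤ ⟪x' - y', x - y⟫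

/-- A set-valued operator is maximal monotone: it is monotone and its graph is not
properly contained in the graph of any other monotone operator. -/
def MaxMonotoneOp (A : H → Set H) : Prop :=
  MonotoneOp A ∧ ∀ B : H → Set H, MonotoneOp B → (∀ x, A x ⊆ B x) → B = A

/-- The (outward) normal cone to a set `C` at `x`: empty when `x ∉ C`. -/
def nCone (C : Set H) (x : H) : Set H :=
  {p | x ∈ C ∧ ∀ c ∈ C, ⟪p, c - x⟫ ≤ 0}

/-- Subdifferential of an extended-real-valued function. -/
def ESubdiff (F : H → EReal) (x : H) : Set H :=
  {p | ∀ y, F x + ((⟪p, y - x⟫ : ℝ) : EReal) ≤ F y}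

/-- Fenchel conjugate of an extended-real-valued function. -/
noncomputable def fenchelConj (F : H → EReal) (p : H) : EReal :=
  ⨆ y, (((⟪y, p⟫ : ℝ) : EReal) - F y)

/-- Support function of a set. -/
noncomputable def suppFun (C : Set H) (p : H) : EReal :=
  ⨆ c : C, ((⟪p, (c : H)⟫ : ℝ) : EReal)

/-- `F : H → EReal` is proper (not identically `+∞`, never `−∞`),
lower-semicontinuous and convex. -/
def ProperLscConvexE (F : H → EReal) : Prop :=
  (∃ x, F x ≠ ⊤) ∧ (∀ x, F x ≠ ⊥) ∧ LowerSemicontinuous F ∧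
    ∀ x y (t : ℝ), 0 ≤ t → t ≤ 1 →
      F (t • x + (1 - t) • y) ≤ ((t : ℝ) : EReal) * F x + (((1 - t : ℝ)) : EReal) * F y

/-- Weak convergence of a sequence in a Hilbert space. -/
def WeakConv (x : ℕ → H) (p : H) : Prop :=
  ∀ y : H, Tendsto (fun n => ⟪x n, y⟫) atTop (𝓝 ⟪p, y⟫)

/-- A weak cluster point: weak limit of some subsequence. -/
def WeakClusterPt (x : ℕ → H) (p : H) : Prop :=
  ∃ φ : ℕ → ℕ, StrictMono φ ∧ WeakConv (x ∘ φ) p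

/-- Boundedly inf-compact function: intersections of balls and sublevel sets are
relatively compact. -/
def BddInfCompact (F : H → EReal) : Prop :=
  ∀ R M : ℝ, 0 ≤ R → IsCompact (closure {p : H | ‖p‖ ≤ R ∧ F p ≤ (M : EReal)})

/-- The data of the (SFBP) algorithm together with hypotheses (H₀). -/
structure SFBP (H : Type*) [NormedAddCommGroup H] [InnerProductSpace ℝ H]
    [CompleteSpace H] where
  /-- the maximal monotone operator -/
  A : H → Set H
  /-- the smooth potential -/
  Φ : H → ℝ
  /-- its gradient -/
  Φ' : H → H
  /-- the smooth penalization potential -/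
  Ψ₁ : H → ℝ
  /-- its gradient -/
  Ψ₁' : H → H
  /-- the nonsmooth penalization potential -/
  Ψ₂ : H → EReal
  /-- the constraint set -/
  C : Set H
  /-- the step sizes -/
  lam : ℕ → ℝ
  /-- the penalization parameters -/
  beta : ℕ → ℝ
  /-- Lipschitz constant of ∇Φ -/
  LΦ : ℝ
  /-- Lipschitz constant of ∇Ψ₁ -/
  LΨ₁ : ℝ
  /-- the sequence generated by the algorithm -/
  x : ℕ → H
  convΦ : ConvexOn ℝ Set.univ Φ
  gradΦ : ∀ p, HasGradientAt Φ (Φ' p) p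
  lipΦ : ∀ p q, ‖Φ' p - Φ' q‖ ≤ LΦ * ‖p - q‖
  convΨ₁ : ConvexOn ℝ Set.univ Ψ₁
  gradΨ₁ : ∀ p, HasGradientAt Ψ₁ (Ψ₁' p) p
  lipΨ₁ : ∀ p q, ‖Ψ₁' p - Ψ₁' q‖ ≤ LΨ₁ * ‖p - q‖
  properΨ₂ : ProperLscConvexE Ψ₂
  Ψ₁nonneg : ∀ p, 0 ≤ Ψ₁ p
  Ψ₂nonneg : ∀ p, (0 : EReal) ≤ Ψ₂ p
  minΨ₁ : ∃ p, Ψ₁ p = 0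
  minΨ₂ : ∃ p, Ψ₂ p = 0
  Cdef : C = {p | ∀ q, Ψ₁ p ≤ Ψ₁ q} ∩ {p | ∀ q, Ψ₂ p ≤ Ψ₂ q}
  Cne : C.Nonempty
  maxmonA : MaxMonotoneOp A
  maxmonT : MaxMonotoneOp
    (fun p => {w | ∃ za ∈ A p, ∃ v ∈ nCone C p, w = za + Φ' p + v})
  Sne : ∃ p, ∃ za ∈ A p, ∃ v ∈ nCone C p, za + Φ' p + v = 0
  lamPos : ∀ n, 0 < lam n
  betaPos : ∀ n, 0 < beta n
  lamDiv : Tendsto (fun N => ∑ k ∈ Finset.range N, lam k) atTop atTop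
  sumSq : Summable fun n => LΦ * lam n ^ 2
  limsupCond : ∃ γ : ℝ, γ < 2 ∧ ∀ᶠ n in atTop, LΨ₁ * (lam n * beta n) ≤ γ
  keyCond : ∀ z : H, (∃ u, z ∈ nCone C u) →
    ∃ M : ℝ, ∀ N : ℕ, ∑ n ∈ Finset.range N,
      (((lam n * beta n : ℝ)) : EReal) *
        (fenchelConj (fun q => ((Ψ₁ q : ℝ) : EReal) + Ψ₂ q) ((beta n)⁻¹ • z)
          - suppFun C ((beta n)⁻¹ • z)) ≤ (M : EReal)
  algo : ∀ n, ∃ a ∈ A (x (n + 1)), ∃ w ∈ ESubdiff Ψ₂ (x (n + 1)),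
    x n - x (n + 1) = lam n • (Φ' (x n) + beta n • Ψ₁' (x n) + a + beta n • w)

/-- The solution set `S = (A + ∇Φ + N_C)⁻¹(0)`. -/
def SFBP.S (d : SFBP H) : Set H :=
  {p | ∃ za ∈ d.A p, ∃ v ∈ nCone d.C p, za + d.Φ' p + v = 0}

theorem aux_grad_ineq {f : H → ℝ} {g : H → H} (hc : ConvexOn ℝ Set.univ f)
    (hg : ∀ p, HasGradientAt f (g p) p) (x y : H) : f x + ⟪g x, y - x⟫ ≤ f y := by
  have hd : HasDerivAt (fun t : ℝ => f (x + t • (y - x))) ⟪g x, y - x⟫ 0 := by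
    have h1 : HasDerivAt (fun t : ℝ => x + t • (y - x)) (y - x) 0 := by
      simpa using ((hasDerivAt_id (0 : ℝ)).smul_const (y - x)).const_add x
    have h2 := (hg x).hasFDerivAt
    have h3 : HasFDerivAt f (InnerProductSpace.toDual ℝ H (g x)) (x + (0 : ℝ) • (y - x)) := by
      simpa using h2
    have h4 := h3.comp_hasDerivAt (0 : ℝ) h1
    rw [InnerProductSpace.toDual_apply_apply] at h4
    exact h4
  have hcv : ConvexOn ℝ Set.univ (fun t : ℝ => f (x + t • (y - x))) := by
    refine ⟨convex_univ, fun a _ b _ s t hs ht hst => ?_⟩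
    have := hc.2 (Set.mem_univ (x + a • (y - x))) (Set.mem_univ (x + b • (y - x))) hs ht hst
    convert this using 2
    have h1 : s = 1 - t := by linarith
    subst h1
    simp only [smul_eq_mul]
    module
  have := hcv.le_slope_of_hasDerivAt (Set.mem_univ 0) (Set.mem_univ 1) zero_lt_one hd
  simp [slope_def_field] at this
  linarith

theorem aux_descent {f : H → ℝ} {g : H → H} {L : ℝ}
    (hg : ∀ p, HasGradientAt f (g p) p) (hl : ∀ p q, ‖g p - g q‖ ≤ L * ‖p - q‖) (x y : H) :
    f y ≤ f x + ⟪g x, y - x⟫ + L / 2 * ‖y - x‖ ^ 2 := by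
  set v := y - x with hv
  have hd : ∀ t : ℝ, HasDerivAt
      (fun t : ℝ => f (x + t • v) - t * ⟪g x, v⟫ - L / 2 * ‖v‖ ^ 2 * t ^ 2)
      (⟪g (x + t • v), v⟫ - ⟪g x, v⟫ - L / 2 * ‖v‖ ^ 2 * (2 * t)) t := by
    intro t
    have h1 : HasDerivAt (fun t : ℝ => x + t • v) v t := by
      simpa using ((hasDerivAt_id t).smul_const v).const_add x
    have h2 := (hg (x + t • v)).hasFDerivAt
    have h3 : HasDerivAt (fun t : ℝ => f (x + t • v)) ⟪g (x + t • v), v⟫ t := by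
      have h4 := h2.comp_hasDerivAt t h1
      rw [InnerProductSpace.toDual_apply_apply] at h4
      exact h4
    have h4 : HasDerivAt (fun t : ℝ => t * ⟪g x, v⟫) ⟪g x, v⟫ t := by
      simpa using (hasDerivAt_id t).mul_const ⟪g x, v⟫
    have h5 : HasDerivAt (fun t : ℝ => L / 2 * ‖v‖ ^ 2 * t ^ 2) (L / 2 * ‖v‖ ^ 2 * (2 * t)) t := by
      simpa using (hasDerivAt_pow 2 t).const_mul (L / 2 * ‖v‖ ^ 2)
    exact (h3.sub h4).sub h5
  have hanti : AntitoneOn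
      (fun t : ℝ => f (x + t • v) - t * ⟪g x, v⟫ - L / 2 * ‖v‖ ^ 2 * t ^ 2) (Set.Ici 0) := by
    apply antitoneOn_of_deriv_nonpos (convex_Ici 0)
    · exact fun t _ => (hd t).continuousAt.continuousWithinAt
    · exact fun t _ => (hd t).differentiableAt.differentiableWithinAt
    · intro t ht
      rw [interior_Ici] at ht
      have ht' : 0 < t := ht
      rw [(hd t).deriv, ← inner_sub_left]
      have h1 := real_inner_le_norm (g (x + t • v) - g x) v
      have h2 := hl (x + t • v) x
      have h3 : ‖x + t • v - x‖ = t * ‖v‖ := by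
        rw [add_sub_cancel_left, norm_smul, Real.norm_of_nonneg ht'.le]
      rw [h3] at h2
      nlinarith [mul_le_mul_of_nonneg_right h2 (norm_nonneg v)]
  have := hanti (Set.mem_Ici.2 le_rfl) (Set.mem_Ici.2 zero_le_one) zero_le_one
  simp only [zero_smul, add_zero, one_smul, zero_mul, one_mul] at this
  have hxy : x + v = y := by rw [hv]; abel
  rw [hxy] at this
  nlinarith

/-- key estimate for a nonnegative smooth convex function vanishing at `u`. -/
theorem aux_psi {f : H → ℝ} {g : H → H} {L θ : ℝ} (hc : ConvexOn ℝ Set.univ f)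
    (hg : ∀ p, HasGradientAt f (g p) p) (hl : ∀ p q, ‖g p - g q‖ ≤ L * ‖p - q‖)
    (hL : 0 ≤ L) (h0 : ∀ p, 0 ≤ f p) (u : H) (hu : f u = 0) (hθ : 0 ≤ θ) (hθ1 : θ ≤ 1)
    (x y : H) :
    θ * f y - (1 + θ) * L / 4 * ‖y - x‖ ^ 2 ≤ ⟪g x, y - u⟫ := by
  have hgu : g u = 0 := by
    have hm : IsLocalMin f u := Filter.Eventually.of_forall fun p => by rw [hu]; exact h0 p
    have := hm.hasFDerivAt_eq_zero (hg u).hasFDerivAt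
    simpa using this
  -- descent part
  have hA : f y - L / 2 * ‖y - x‖ ^ 2 ≤ ⟪g x, y - u⟫ := by
    have h1 := aux_descent hg hl x y
    have h2 := aux_grad_ineq hc hg x u
    have h3 : ⟪g x, y - u⟫ = ⟪g x, y - x⟫ - ⟪g x, u - x⟫ := by
      rw [← inner_sub_right]; congr 1; abel
    linarith
  have hB : - (L / 4 * ‖y - x‖ ^ 2) ≤ ⟪g x, y - u⟫ := by
    rcases hL.eq_or_lt with hL0 | hL0
    · have := hl x u
      rw [← hL0, hgu] at this
      have : g x = 0 := by simpa using this
      rw [this, ← hL0]; simp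
    have h1 := aux_descent hg hl u (u + L⁻¹ • g x)
    have h2 := aux_grad_ineq hc hg x (u + L⁻¹ • g x)
    have h3 := aux_descent hg hl x (x - L⁻¹ • g x)
    have h4 := h0 (x - L⁻¹ • g x)
    have e1 : u + L⁻¹ • g x - u = L⁻¹ • g x := by abel
    have e2 : u + L⁻¹ • g x - x = L⁻¹ • g x - (x - u) := by abel
    have e3 : x - L⁻¹ • g x - x = - (L⁻¹ • g x) := by abel
    rw [e1, hgu, hu, norm_smul, mul_pow, Real.norm_of_nonneg (by positivity)] at h1
    rw [e2, inner_sub_right, inner_smul_right, real_inner_self_eq_norm_sq] at h2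
    rw [e3, inner_neg_right, inner_smul_right, real_inner_self_eq_norm_sq, norm_neg, norm_smul,
      mul_pow, Real.norm_of_nonneg (by positivity)] at h3
    rw [inner_zero_left] at h1
    have e4 : L / 2 * (L⁻¹ ^ 2 * ‖g x‖ ^ 2) = L⁻¹ * ‖g x‖ ^ 2 / 2 := by field_simp
    rw [e4] at h1 h3
    have h5 : L⁻¹ * ‖g x‖ ^ 2 ≤ ⟪g x, x - u⟫ := by linarith
    have h6 : ⟪g x, y - u⟫ = ⟪g x, y - x⟫ + ⟪g x, x - u⟫ := by
      rw [← inner_add_right]; congr 1; abel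
    have h7 := neg_le_of_abs_le (abs_real_inner_le_norm (g x) (y - x))
    have h8 : 0 ≤ L⁻¹ * (‖g x‖ - L / 2 * ‖y - x‖) ^ 2 := by positivity
    have e5 : L⁻¹ * (‖g x‖ - L / 2 * ‖y - x‖) ^ 2
        = L⁻¹ * ‖g x‖ ^ 2 - ‖g x‖ * ‖y - x‖ + L / 4 * ‖y - x‖ ^ 2 := by field_simp; ring
    linarith
  nlinarith [mul_le_mul_of_nonneg_left hA hθ, mul_le_mul_of_nonneg_left hB (sub_nonneg.2 hθ1)]

theorem aux_C (d : SFBP H) {u : H} (hu : u ∈ d.C) : d.Ψ₁ u = 0 ∧ d.Ψ₂ u = 0 := by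
  rw [d.Cdef] at hu
  obtain ⟨p, hp⟩ := d.minΨ₁
  obtain ⟨q, hq⟩ := d.minΨ₂
  exact ⟨le_antisymm (hp ▸ hu.1 p) (d.Ψ₁nonneg u), le_antisymm (hq ▸ hu.2 q) (d.Ψ₂nonneg u)⟩

theorem aux_key (d : SFBP H) {u z : H} (hz : z ∈ nCone d.C u) :
    ∃ t : ℕ → ℝ, (∀ n, 0 ≤ t n) ∧ Summable t ∧ ∀ n q (r : ℝ), d.Ψ₂ q = (r : EReal) →
      d.lam n * d.beta n * (⟪(d.beta n)⁻¹ • z, q - u⟫ - d.Ψ₁ q - r) ≤ t n := by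
  obtain ⟨M, hM⟩ := d.keyCond z ⟨u, hz⟩
  set D : ℕ → EReal := fun n => (((d.lam n * d.beta n : ℝ)) : EReal) *
        (fenchelConj (fun q => ((d.Ψ₁ q : ℝ) : EReal) + d.Ψ₂ q) ((d.beta n)⁻¹ • z)
          - suppFun d.C ((d.beta n)⁻¹ • z)) with hD
  have hsupp : ∀ n, suppFun d.C ((d.beta n)⁻¹ • z) ≤ ((⟪(d.beta n)⁻¹ • z, u⟫ : ℝ) : EReal) := by
    intro n
    refine iSup_le fun c => ?_
    rw [EReal.coe_le_coe_iff]
    have h1 := hz.2 c c.2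
    have h2 : 0 ≤ (d.beta n)⁻¹ := (inv_pos.2 (d.betaPos n)).le
    have h3 : ⟪(d.beta n)⁻¹ • z, (c : H) - u⟫ ≤ 0 := by
      rw [inner_smul_left]; exact mul_nonpos_of_nonneg_of_nonpos h2 h1
    rw [inner_sub_right] at h3
    linarith
  have hlow : ∀ n q (r : ℝ), d.Ψ₂ q = (r : EReal) →
      ((d.lam n * d.beta n * (⟪(d.beta n)⁻¹ • z, q - u⟫ - d.Ψ₁ q - r) : ℝ) : EReal) ≤ D n := by
    intro n q r hr
    rw [EReal.coe_mul]
    apply mul_le_mul_of_nonneg_left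
    · have h1 : ((⟪q, (d.beta n)⁻¹ • z⟫ - (d.Ψ₁ q + r) : ℝ) : EReal) ≤
          fenchelConj (fun q => ((d.Ψ₁ q : ℝ) : EReal) + d.Ψ₂ q) ((d.beta n)⁻¹ • z) := by
        have := le_iSup (fun y => (((⟪y, (d.beta n)⁻¹ • z⟫ : ℝ) : EReal) -
          (((d.Ψ₁ y : ℝ) : EReal) + d.Ψ₂ y))) q
        rw [hr] at this
        rw [EReal.coe_sub, EReal.coe_add]
        exact this
      have h2 := EReal.sub_le_sub h1 (hsupp n)
      refine le_trans (le_of_eq ?_) h2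
      rw [← EReal.coe_sub, EReal.coe_eq_coe_iff, inner_sub_right, real_inner_comm q]
      ring
    · exact_mod_cast (mul_pos (d.lamPos n) (d.betaPos n)).le
  have hD0 : ∀ n, 0 ≤ D n := by
    intro n
    obtain ⟨h1, h2⟩ := aux_C d hz.1
    have := hlow n u 0 (by simpa using h2)
    simpa [h1] using this
  have hDM : ∀ n, D n ≤ (M : EReal) := fun n => by
    refine le_trans ?_ (hM (n + 1))
    exact Finset.single_le_sum (f := D) (fun i _ => hD0 i) (Finset.mem_range.2 (Nat.lt_succ_self n))
  have hcoe : ∀ n, ((D n).toReal : EReal) = D n := fun n =>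
    EReal.coe_toReal (ne_top_of_le_ne_top (EReal.coe_ne_top M) (hDM n))
      (ne_bot_of_le_ne_bot (by simp) (hD0 n))
  have ht0 : ∀ n, 0 ≤ (D n).toReal := fun n => EReal.toReal_nonneg (hD0 n)
  refine ⟨fun n => (D n).toReal, ht0, ?_, ?_⟩
  · refine summable_of_sum_range_le (c := M) ht0 fun N => ?_
    have := hM N
    rw [← EReal.coe_le_coe_iff]
    refine le_trans (le_of_eq ?_) this
    have hs : ∀ s : Finset ℕ, ((∑ i ∈ s, (D i).toReal : ℝ) : EReal) = ∑ i ∈ s, D i := by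
      intro s
      induction s using Finset.induction_on with
      | empty => simp
      | insert a s ha ih =>
        rw [Finset.sum_insert ha, Finset.sum_insert ha, EReal.coe_add, ih, hcoe]
    exact hs _
  · intro n q r hr
    have := hlow n q r hr
    rw [← hcoe n] at this
    exact EReal.coe_le_coe_iff.1 this

theorem aux_ev (d : SFBP H) : ∃ θ : ℝ, 0 < θ ∧ θ ≤ 1 ∧ ∀ᶠ n in atTop,
    d.LΦ * d.lam n + d.lam n * d.beta n * max d.LΨ₁ 0 * (1 + θ) / 2 ≤ 1 := by
  obtain ⟨γ, hγ, hev⟩ := d.limsupCond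
  set γ' := max γ 0 with hγ'
  have hγ2 : γ' < 2 := max_lt hγ (by norm_num)
  have hγ0 : 0 ≤ γ' := le_max_right _ _
  refine ⟨(2 - γ') / 4, by linarith, by linarith, ?_⟩
  set θ := (2 - γ') / 4 with hθ
  have hθ0 : 0 < θ := by rw [hθ]; linarith
  have hphi : ∀ᶠ n in atTop, d.LΦ * d.lam n ≤ θ := by
    have h1 := d.sumSq.tendsto_atTop_zero.const_mul d.LΦ
    rw [mul_zero] at h1
    filter_upwards [h1.eventually (gt_mem_nhds (show (0:ℝ) < θ ^ 2 by positivity))] with n hn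
    refine (abs_le_of_sq_le_sq' ?_ hθ0.le).2
    nlinarith
  filter_upwards [hev, hphi] with n h1 h2
  have hlb := mul_pos (d.lamPos n) (d.betaPos n)
  have h3 : d.lam n * d.beta n * max d.LΨ₁ 0 ≤ γ' := by
    rcases le_total d.LΨ₁ 0 with h | h
    · rw [max_eq_right h]; simpa using hγ0
    · rw [max_eq_left h]
      exact le_trans (by linarith) (le_max_left γ 0)
  have h4 : d.lam n * d.beta n * max d.LΨ₁ 0 * (1 + θ) ≤ γ' * (1 + θ) :=
    mul_le_mul_of_nonneg_right h3 (by linarith)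
  nlinarith

theorem aux_main (d : SFBP H) {u w za v : H} (hza : za ∈ d.A u) (hv : v ∈ nCone d.C u)
    (hw : w = za + d.Φ' u + v) :
    ∃ s : ℕ → ℝ, (∀ n, 0 ≤ s n) ∧ Summable s ∧ ∀ n,
      ‖d.x (n + 1) - u‖ ^ 2 + 2 * d.lam n * ⟪w, d.x (n + 1) - u⟫ ≤ ‖d.x n - u‖ ^ 2 + s n := by
  obtain ⟨θ, hθ, hθ1, hev⟩ := aux_ev d
  have hv' : θ⁻¹ • v ∈ nCone d.C u := by
    refine ⟨hv.1, fun c hc => ?_⟩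
    rw [inner_smul_left]
    exact mul_nonpos_of_nonneg_of_nonpos (by simpa using hθ.le) (hv.2 c hc)
  obtain ⟨t, ht0, hts, htn⟩ := aux_key d hv'
  obtain ⟨hu1, hu2⟩ := aux_C d hv.1
  have hmain : ∀ᶠ n in atTop, ‖d.x (n + 1) - u‖ ^ 2 + 2 * d.lam n * ⟪w, d.x (n + 1) - u⟫
      ≤ ‖d.x n - u‖ ^ 2 + 2 * θ * t n := by
    filter_upwards [hev] with n hn
    obtain ⟨a, ha, b, hb, hx⟩ := d.algo n
    set X := d.x (n + 1) with hX
    set Y := d.x n with hY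
    have hl := d.lamPos n
    have hbt := d.betaPos n
    -- Ψ₂
    have hb1 := hb u
    rw [hu2] at hb1
    have hnt : d.Ψ₂ X ≠ ⊤ := by
      intro h
      rw [h, EReal.top_add_coe] at hb1
      simp at hb1
    obtain ⟨r, hr⟩ : ∃ r : ℝ, d.Ψ₂ X = (r : EReal) :=
      ⟨(d.Ψ₂ X).toReal, (EReal.coe_toReal hnt (d.properΨ₂.2.1 X)).symm⟩
    have hr0 : 0 ≤ r := by have := d.Ψ₂nonneg X; rw [hr] at this; exact_mod_cast this
    have hbr : r ≤ ⟪b, X - u⟫ := by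
      rw [hr] at hb1
      have h1 : r + ⟪b, u - X⟫ ≤ 0 := by exact_mod_cast hb1
      have h2 : ⟪b, u - X⟫ = - ⟪b, X - u⟫ := by rw [← inner_neg_right]; congr 1; abel
      linarith
    -- A
    have hA := d.maxmonA.1 X u a za ha hza
    rw [inner_sub_left] at hA
    -- Φ
    have hP : ⟪d.Φ' u, X - u⟫ - d.LΦ / 2 * ‖X - Y‖ ^ 2 ≤ ⟪d.Φ' Y, X - u⟫ := by
      have h1 := aux_descent d.gradΦ d.lipΦ Y X
      have h2 := aux_grad_ineq d.convΦ d.gradΦ Y u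
      have h4 := aux_grad_ineq d.convΦ d.gradΦ u X
      have h3 : ⟪d.Φ' Y, X - u⟫ = ⟪d.Φ' Y, X - Y⟫ - ⟪d.Φ' Y, u - Y⟫ := by
        rw [← inner_sub_right]; congr 1; abel
      linarith
    -- Ψ₁
    have hQ := aux_psi (L := max d.LΨ₁ 0) d.convΨ₁ d.gradΨ₁
      (fun p q => (d.lipΨ₁ p q).trans
        (mul_le_mul_of_nonneg_right (le_max_left _ _) (norm_nonneg _)))
      (le_max_right _ _) d.Ψ₁nonneg u hu1 hθ.le hθ1 Y X
    have hk := htn n X r hr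
    have hid : ‖X - u‖ ^ 2 - ‖Y - u‖ ^ 2 + ‖X - Y‖ ^ 2 = - 2 * ⟪Y - X, X - u⟫ := by
      have : Y - u = (Y - X) + (X - u) := by abel
      rw [this, norm_add_sq_real, norm_sub_rev X Y]; ring
    rw [hx, inner_smul_left, inner_add_left, inner_add_left, inner_add_left, inner_smul_left,
      inner_smul_left] at hid
    simp only [RCLike.conj_to_real] at hid
    rw [inner_smul_left, inner_smul_left] at hk
    simp only [RCLike.conj_to_real] at hk
    have hk2 : d.lam n * ⟪v, X - u⟫ - θ * (d.lam n * d.beta n * (d.Ψ₁ X + r)) ≤ θ * t n := by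
      have := mul_le_mul_of_nonneg_left hk hθ.le
      refine le_trans (le_of_eq ?_) this
      field_simp
      ring
    rw [hw, inner_add_left, inner_add_left]
    have hlb := mul_pos hl hbt
    have m1 := mul_le_mul_of_nonneg_left hA hl.le
    have m2 := mul_le_mul_of_nonneg_left hP hl.le
    have m3 := mul_le_mul_of_nonneg_left hQ hlb.le
    have m4 := mul_le_mul_of_nonneg_left hbr hlb.le
    have m5 := mul_le_mul_of_nonneg_right hn (sq_nonneg ‖X - Y‖)
    have m6 : θ * (d.lam n * d.beta n * r) ≤ d.lam n * d.beta n * r :=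
      mul_le_of_le_one_left (by positivity) hθ1
    have hW := norm_nonneg (X - Y)
    generalize max d.LΨ₁ 0 = L at *
    generalize ‖X - Y‖ ^ 2 = W at *
    linarith
  obtain ⟨N, hN⟩ := eventually_atTop.1 hmain
  refine ⟨fun n => if n < N then |‖d.x (n + 1) - u‖ ^ 2 + 2 * d.lam n * ⟪w, d.x (n + 1) - u⟫
    - ‖d.x n - u‖ ^ 2| else 2 * θ * t n, ?_, ?_, ?_⟩
  · intro n
    dsimp only
    split_ifs
    · exact abs_nonneg _
    · have := ht0 n; positivity
  · rw [← summable_nat_add_iff N]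
    simpa using (summable_nat_add_iff N).2 (hts.mul_left (2 * θ))
  · intro n
    dsimp only
    split_ifs with h
    · linarith [le_abs_self (‖d.x (n + 1) - u‖ ^ 2 + 2 * d.lam n * ⟪w, d.x (n + 1) - u⟫
        - ‖d.x n - u‖ ^ 2)]
    · exact hN n (not_lt.1 h)

theorem aux_conv {a s : ℕ → ℝ} (ha : ∀ n, 0 ≤ a n) (hs0 : ∀ n, 0 ≤ s n) (hs : Summable s)
    (h : ∀ n, a (n + 1) ≤ a n + s n) : ∃ l, Tendsto a atTop (𝓝 l) := by
  have hanti : Antitone fun n => a n - ∑ k ∈ Finset.range n, s k := by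
    refine antitone_nat_of_succ_le fun n => ?_
    rw [Finset.sum_range_succ]
    linarith [h n]
  have hb : BddBelow (Set.range fun n => a n - ∑ k ∈ Finset.range n, s k) := by
    refine ⟨- ∑' k, s k, ?_⟩
    rintro _ ⟨n, rfl⟩
    have := hs.sum_le_tsum (Finset.range n) (fun i _ => hs0 i)
    have := ha n
    dsimp only
    linarith
  have h1 := tendsto_atTop_ciInf hanti hb
  have h2 := hs.hasSum.tendsto_sum_nat
  exact ⟨_, by simpa using h1.add h2⟩

theorem aux_cesaro {lam c : ℕ → ℝ} {l : ℝ} (hl : ∀ n, 0 < lam n)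
    (hd : Tendsto (fun N => ∑ k ∈ Finset.range N, lam k) atTop atTop)
    (hc : Tendsto c atTop (𝓝 l)) :
    Tendsto (fun n => (∑ k ∈ Finset.range (n + 1), lam k)⁻¹ *
      ∑ k ∈ Finset.range (n + 1), lam k * c k) atTop (𝓝 l) := by
  have h1 : (fun k => lam k * (c k - l)) =o[atTop] lam := by
    have h2 : (fun k => c k - l) =o[atTop] (fun _ => (1 : ℝ)) := by
      rw [Asymptotics.isLittleO_one_iff]
      simpa using hc.sub_const l
    simpa using (Asymptotics.isBigO_refl lam atTop).mul_isLittleO h2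
  have h2 := (h1.sum_range (fun n => (hl n).le) hd).tendsto_div_nhds_zero
  have h3 := (tendsto_add_atTop_iff_nat 1).2 h2
  have h4 := h3.add_const l
  rw [zero_add] at h4
  refine h4.congr fun n => ?_
  have hp : 0 < ∑ k ∈ Finset.range (n + 1), lam k :=
    Finset.sum_pos (fun i _ => hl i) (by simp)
  simp only [mul_sub, Finset.sum_sub_distrib, ← Finset.sum_mul]
  field_simp
  ring

theorem aux_ultra {z : ℕ → H} {K : ℝ} (hz : ∀ n, ‖z n‖ ≤ K) (F : Ultrafilter ℕ) :
    ∃ p : H, ∀ y, Tendsto (fun n => ⟪z n, y⟫) F (𝓝 ⟪p, y⟫) := by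
  let Z : ℕ → WeakDual ℝ H := fun n => StrongDual.toWeakDual (InnerProductSpace.toDual ℝ H (z n))
  have hc := WeakDual.isCompact_closedBall (𝕜 := ℝ) (0 : StrongDual ℝ H) K
  have hm : ∀ n, Z n ∈ WeakDual.toStrongDual ⁻¹' Metric.closedBall (0 : StrongDual ℝ H) K := by
    intro n
    have : ‖InnerProductSpace.toDual ℝ H (z n)‖ ≤ K := by simpa using hz n
    simpa [Z] using this
  obtain ⟨f, -, hf⟩ := hc.ultrafilter_le_nhds' (F.map Z)
    (Ultrafilter.mem_map.2 (Filter.Eventually.of_forall hm))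
  refine ⟨(InnerProductSpace.toDual ℝ H).symm (WeakDual.toStrongDual f), fun y => ?_⟩
  have h1 : Tendsto Z F (𝓝 f) := hf
  have h2 := ((WeakDual.eval_continuous y).tendsto f).comp h1
  have h3 : ⟪(InnerProductSpace.toDual ℝ H).symm (WeakDual.toStrongDual f), y⟫ = f y := by
    rw [InnerProductSpace.toDual_symm_apply]; rfl
  rw [h3]
  exact h2

/-- **Theorem 2.1, part 1.** Under hypotheses (H₀), the averaged sequence
`ẑ_n = τ_n⁻¹ ∑_{k≤n} λ_k x_{k+1}` converges weakly to a point of `S`. -/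
theorem sfbp_weak_ergodic_hatz (d : SFBP H) :
    ∃ p ∈ d.S, WeakConv (fun n =>
      (∑ k ∈ Finset.range (n + 1), d.lam k)⁻¹ •
        ∑ k ∈ Finset.range (n + 1), d.lam k • d.x (k + 1)) p := by
  classical
  set z : ℕ → H := fun n => (∑ k ∈ Finset.range (n + 1), d.lam k)⁻¹ •
        ∑ k ∈ Finset.range (n + 1), d.lam k • d.x (k + 1) with hz
  have hτ : ∀ n, 0 < ∑ k ∈ Finset.range (n + 1), d.lam k := fun n =>
    Finset.sum_pos (fun i _ => d.lamPos i) (by simp)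
  have hzi : ∀ n y, ⟪z n, y⟫ = (∑ k ∈ Finset.range (n + 1), d.lam k)⁻¹ *
      ∑ k ∈ Finset.range (n + 1), d.lam k * ⟪d.x (k + 1), y⟫ := by
    intro n y
    simp [hz, inner_smul_left, sum_inner]
  -- convergence of distances to solutions
  have hdist : ∀ u ∈ d.S, ∃ l, Tendsto (fun n => ‖d.x n - u‖ ^ 2) atTop (𝓝 l) := by
    rintro u ⟨za, hza, v, hv, h0⟩
    obtain ⟨s, hs0, hs, hn⟩ := aux_main d hza hv h0.symm
    exact aux_conv (fun n => sq_nonneg _) hs0 hs (fun n => by simpa using hn n)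
  -- boundedness
  obtain ⟨K, hK⟩ : ∃ K, ∀ n, ‖d.x n‖ ≤ K := by
    obtain ⟨u, hu⟩ := d.Sne
    obtain ⟨l, hl⟩ := hdist u hu
    obtain ⟨B, hB⟩ := hl.bddAbove_range
    refine ⟨(B + 1) + ‖u‖, fun n => ?_⟩
    have h1 : ‖d.x n - u‖ ^ 2 ≤ B := hB ⟨n, rfl⟩
    have h2 : ‖d.x n‖ ≤ ‖d.x n - u‖ + ‖u‖ := by simpa using norm_add_le (d.x n - u) u
    nlinarith [sq_nonneg (‖d.x n - u‖ - 1), norm_nonneg (d.x n - u)]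
  have hzK : ∀ n, ‖z n‖ ≤ K := by
    intro n
    rw [hz]
    dsimp only
    rw [norm_smul, norm_inv, Real.norm_of_nonneg (hτ n).le, inv_mul_le_iff₀ (hτ n), Finset.sum_mul]
    refine (norm_sum_le _ _).trans (Finset.sum_le_sum fun k _ => ?_)
    rw [norm_smul, Real.norm_of_nonneg (d.lamPos k).le]
    exact mul_le_mul_of_nonneg_left (hK _) (d.lamPos k).le
  -- cluster points belong to S
  have hclu : ∀ (F : Ultrafilter ℕ), (F : Filter ℕ) ≤ atTop → ∀ p : H,
      (∀ y, Tendsto (fun n => ⟪z n, y⟫) F (𝓝 ⟪p, y⟫)) → p ∈ d.S := by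
    intro F hF p hp
    have hkey : ∀ u w, (∃ za ∈ d.A u, ∃ v ∈ nCone d.C u, w = za + d.Φ' u + v) →
        ⟪w, p - u⟫ ≤ 0 := by
      rintro u w ⟨za, hza, v, hv, hw⟩
      obtain ⟨s, hs0, hs, hn⟩ := aux_main d hza hv hw
      have hsum : ∀ N, ‖d.x N - u‖ ^ 2 + 2 * ∑ k ∈ Finset.range N, d.lam k * ⟪w, d.x (k + 1) - u⟫
          ≤ ‖d.x 0 - u‖ ^ 2 + ∑ k ∈ Finset.range N, s k := by
        intro N
        induction N with
        | zero => simp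
        | succ N ih =>
          rw [Finset.sum_range_succ, Finset.sum_range_succ]
          linarith [hn N]
      set M := (‖d.x 0 - u‖ ^ 2 + ∑' k, s k) / 2 with hM
      have hle : ∀ n, ⟪w, z n - u⟫ ≤ (∑ k ∈ Finset.range (n + 1), d.lam k)⁻¹ * M := by
        intro n
        have h1 := hsum (n + 1)
        have h2 := hs.sum_le_tsum (Finset.range (n + 1)) (fun i _ => hs0 i)
        have h3 : ⟪w, z n - u⟫ = (∑ k ∈ Finset.range (n + 1), d.lam k)⁻¹ *
            ∑ k ∈ Finset.range (n + 1), d.lam k * ⟪w, d.x (k + 1) - u⟫ := by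
          rw [inner_sub_right, real_inner_comm, hzi]
          simp only [inner_sub_right, mul_sub, Finset.sum_sub_distrib, ← Finset.sum_mul]
          rw [inv_mul_cancel_left₀ (hτ n).ne']
          simp only [real_inner_comm]
        rw [h3]
        refine mul_le_mul_of_nonneg_left ?_ (inv_nonneg.2 (hτ n).le)
        have := sq_nonneg ‖d.x (n + 1) - u‖
        rw [hM]
        linarith
      have hlim0 : Tendsto (fun n => (∑ k ∈ Finset.range (n + 1), d.lam k)⁻¹ * M) atTop (𝓝 0) := by
        have := (tendsto_inv_atTop_zero.comp
          ((tendsto_add_atTop_iff_nat 1).2 d.lamDiv)).mul_const M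
        simpa using this
      have hlim1 : Tendsto (fun n => ⟪w, z n - u⟫) F (𝓝 ⟪w, p - u⟫) := by
        have := (hp w).sub_const ⟪w, u⟫
        simp only [inner_sub_right]
        simpa only [real_inner_comm w] using this
      exact le_of_tendsto_of_tendsto' hlim1 (hlim0.mono_left hF) hle
    set T : H → Set H :=
      fun p => {w | ∃ za ∈ d.A p, ∃ v ∈ nCone d.C p, w = za + d.Φ' p + v} with hT
    have hmm : MaxMonotoneOp T := d.maxmonT
    have hB := hmm.2 (fun q => T q ∪ {w | q = p ∧ w = 0}) ?_ (fun q => Set.subset_union_left)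
    · have h0 : (0 : H) ∈ T p := by
        rw [← hB]; exact Or.inr ⟨rfl, rfl⟩
      obtain ⟨za, hza, v, hv, h⟩ := h0
      exact ⟨za, hza, v, hv, h.symm⟩
    · rintro a b a' b' (ha | ⟨rfl, rfl⟩) (hb | ⟨rfl, rfl⟩)
      · exact hmm.1 a b a' b' ha hb
      · have := hkey a a' ha
        have e : ⟪a' - 0, a - b⟫ = - ⟪a', b - a⟫ := by
          rw [sub_zero, ← inner_neg_right]; congr 1; abel
        linarith
      · have := hkey b b' hb
        have e : ⟪0 - b', a - b⟫ = - ⟪b', a - b⟫ := by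
          rw [zero_sub, inner_neg_left]
        linarith
      · simp
  -- uniqueness
  have huniq : ∀ p ∈ d.S, ∀ q ∈ d.S, ∃ l, Tendsto (fun n => ⟪z n, p - q⟫) atTop (𝓝 l) := by
    intro p hp q hq
    obtain ⟨l1, h1⟩ := hdist p hp
    obtain ⟨l2, h2⟩ := hdist q hq
    have h3 : Tendsto (fun n => ⟪d.x n, p - q⟫) atTop
        (𝓝 ((l2 - l1 + (‖p‖ ^ 2 - ‖q‖ ^ 2)) / 2)) := by
      refine (((h2.sub h1).add_const (‖p‖ ^ 2 - ‖q‖ ^ 2)).div_const 2).congr fun n => ?_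
      rw [norm_sub_sq_real, norm_sub_sq_real, inner_sub_right]
      ring
    have h4 := aux_cesaro d.lamPos d.lamDiv ((tendsto_add_atTop_iff_nat 1).2 h3)
    exact ⟨_, h4.congr fun n => (hzi n _).symm⟩
  obtain ⟨p, hp⟩ := aux_ultra hzK (Ultrafilter.of atTop)
  have hpS := hclu _ (Ultrafilter.of_le atTop) p hp
  refine ⟨p, hpS, fun y => ?_⟩
  rw [tendsto_iff_ultrafilter]
  intro F hF
  obtain ⟨q, hq⟩ := aux_ultra hzK F
  have hqS := hclu F hF q hq
  obtain ⟨l, hl⟩ := huniq p hpS q hqS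
  have e1 := tendsto_nhds_unique (hp (p - q)) (hl.mono_left (Ultrafilter.of_le atTop))
  have e2 := tendsto_nhds_unique (hq (p - q)) (hl.mono_left hF)
  have e3 : ⟪p - q, p - q⟫ = 0 := by rw [inner_sub_left, e1, e2, sub_self]
  have e4 : p = q := sub_eq_zero.1 (inner_self_eq_zero.1 e3)
  rw [e4]
  exact hq y
end

section
/- (Theorem 2.1, part 2) Assume hypotheses (H₀) and moreover that (λ_n) ∈ ℓ², i.e. ∑ λ_n² < +∞. Then the averaged sequence z_n = (1/τ_n) ∑_{k=1}^n λ_k x_k, where τ_n = ∑_{k=1}^n λ_k, converges weakly to a point of S as n → ∞. -/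
open Filter Topology
open scoped RealInnerProductSpace

variable {H : Type*} [NormedAddCommGroup H] [InnerProductSpace ℝ H] [CompleteSpace H]

namespace SFBPaux

lemma hasDerivAt_line {f : H → ℝ} {g : H → H} (hg : ∀ p, HasGradientAt f (g p) p) (x d : H) (t : ℝ) :
    HasDerivAt (fun s : ℝ => f (x + s • d)) ⟪g (x + t • d), d⟫ t := by
  have h1 : HasDerivAt (fun s : ℝ => x + s • d) d t := by
    simpa using ((hasDerivAt_id t).smul_const d).const_add x
  have h2 := (hg (x + t • d)).hasFDerivAt.comp_hasDerivAt t h1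
  rw [InnerProductSpace.toDual_apply_apply] at h2
  exact h2

lemma grad_ineq {f : H → ℝ} {g : H → H} (hf : ConvexOn ℝ Set.univ f)
    (hg : ∀ p, HasGradientAt f (g p) p) (x y : H) : f x + ⟪g x, y - x⟫ ≤ f y := by
  have hc : ConvexOn ℝ Set.univ (fun s : ℝ => f (x + s • (y - x))) := by
    refine ⟨convex_univ, fun a _ b _ s t hs ht hst => ?_⟩
    have := hf.2 (Set.mem_univ (x + a • (y - x))) (Set.mem_univ (x + b • (y - x))) hs ht hst
    refine le_trans (le_of_eq ?_) this
    refine congrArg f ?_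
    obtain rfl : t = 1 - s := by linarith
    simp only [smul_eq_mul]
    module
  have h := hc.le_slope_of_hasDerivAt (Set.mem_univ 0) (Set.mem_univ 1) one_pos
    (hasDerivAt_line hg x (y - x) 0)
  simp [slope_def_field] at h
  linarith

lemma descent {f : H → ℝ} {g : H → H} {L : ℝ}
    (hg : ∀ p, HasGradientAt f (g p) p) (hL : ∀ p q, ‖g p - g q‖ ≤ L * ‖p - q‖) (x y : H) :
    f y ≤ f x + ⟪g x, y - x⟫ + L / 2 * ‖y - x‖ ^ 2 := by
  set d := y - x with hd
  let φ : ℝ → ℝ := fun s => f (x + s • d) - s * ⟪g x, d⟫ - L / 2 * s ^ 2 * ‖d‖ ^ 2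
  have hder : ∀ t, HasDerivAt φ (⟪g (x + t • d), d⟫ - ⟪g x, d⟫ - L * t * ‖d‖ ^ 2) t := by
    intro t
    have h1 := hasDerivAt_line hg x d t
    have h2 : HasDerivAt (fun s : ℝ => s * ⟪g x, d⟫) ⟪g x, d⟫ t := by
      simpa using (hasDerivAt_id t).mul_const ⟪g x, d⟫
    have h3 : HasDerivAt (fun s : ℝ => L / 2 * s ^ 2 * ‖d‖ ^ 2) (L * t * ‖d‖ ^ 2) t := by
      refine (((hasDerivAt_pow 2 t).const_mul (L / 2)).mul_const (‖d‖ ^ 2)).congr_deriv ?_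
      push_cast
      ring
    exact (h1.sub h2).sub h3
  have hanti : AntitoneOn φ (Set.Icc 0 1) := by
    apply antitoneOn_of_deriv_nonpos (convex_Icc 0 1)
    · exact fun t _ => (hder t).continuousAt.continuousWithinAt
    · exact fun t _ => (hder t).differentiableAt.differentiableWithinAt
    · intro t ht
      rw [interior_Icc] at ht
      rw [(hder t).deriv, ← inner_sub_left]
      have h1 := real_inner_le_norm (g (x + t • d) - g x) d
      have h2 := hL (x + t • d) x
      have h3 : ‖x + t • d - x‖ = t * ‖d‖ := by
        rw [add_sub_cancel_left, norm_smul, Real.norm_of_nonneg ht.1.le]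
      rw [h3] at h2
      nlinarith [norm_nonneg d]
  have := hanti (Set.left_mem_Icc.2 zero_le_one) (Set.right_mem_Icc.2 zero_le_one) zero_le_one
  simp [φ] at this
  have e : x + d = y := by rw [hd]; abel
  rw [e] at this
  linarith

/-- Robbins–Siegmund type lemma. -/
lemma quasi_fejer {a b δ : ℕ → ℝ} (ha : ∀ n, 0 ≤ a n) (hb : ∀ n, 0 ≤ b n) (hδ : ∀ n, 0 ≤ δ n)
    (sb : Summable b) (sδ : Summable δ) (N : ℕ)
    (h : ∀ n ≥ N, a (n + 1) ≤ (1 + b n) * a n + δ n) : ∃ l, Tendsto a atTop (𝓝 l) := by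
  set a' := fun n => a (n + N) with ha'
  set b' := fun n => b (n + N) with hb'
  set δ' := fun n => δ (n + N) with hδ'
  have sb' : Summable b' := (summable_nat_add_iff N).2 sb
  have sδ' : Summable δ' := (summable_nat_add_iff N).2 sδ
  have hb0 : ∀ n, 0 ≤ b' n := fun n => hb _
  have hδ0 : ∀ n, 0 ≤ δ' n := fun n => hδ _
  have ha0 : ∀ n, 0 ≤ a' n := fun n => ha _
  have h' : ∀ n, a' (n + 1) ≤ (1 + b' n) * a' n + δ' n := by
    intro n
    have := h (n + N) (by omega)
    simp only [ha', hb', hδ']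
    rwa [show n + 1 + N = n + N + 1 by ring]
  have hbd : ∀ n, a' n ≤ Real.exp (∑ k ∈ Finset.range n, b' k) *
      (a' 0 + ∑ k ∈ Finset.range n, δ' k) := by
    intro n
    induction n with
    | zero => simp
    | succ n ih =>
      rw [Finset.sum_range_succ, Finset.sum_range_succ, Real.exp_add]
      have e1 : 1 + b' n ≤ Real.exp (b' n) := by linarith [Real.add_one_le_exp (b' n)]
      have hs : 0 ≤ ∑ k ∈ Finset.range n, b' k := Finset.sum_nonneg fun k _ => hb0 k
      have e2 : 1 ≤ Real.exp (∑ k ∈ Finset.range n, b' k) * Real.exp (b' n) := by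
        rw [← Real.exp_add]
        exact Real.one_le_exp (add_nonneg hs (hb0 n))
      have e3 : (1 + b' n) * a' n ≤ Real.exp (b' n) * (Real.exp (∑ k ∈ Finset.range n, b' k) *
          (a' 0 + ∑ k ∈ Finset.range n, δ' k)) :=
        mul_le_mul e1 ih (ha0 n) (Real.exp_pos _).le
      have e4 := mul_le_mul_of_nonneg_right e2 (hδ0 n)
      have := h' n
      nlinarith
  set M := Real.exp (∑' k, b' k) * (a' 0 + ∑' k, δ' k) with hM
  have hbd2 : ∀ n, a' n ≤ M := by
    intro n
    refine (hbd n).trans ?_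
    have i1 := sb'.sum_le_tsum (Finset.range n) (fun k _ => hb0 k)
    have i2 := sδ'.sum_le_tsum (Finset.range n) (fun k _ => hδ0 k)
    have i3 : 0 ≤ ∑ k ∈ Finset.range n, δ' k := Finset.sum_nonneg fun k _ => hδ0 k
    exact mul_le_mul (Real.exp_le_exp.2 i1) (by linarith) (by linarith [ha0 0])
      (Real.exp_pos _).le
  set η := fun n => b' n * M + δ' n with hη
  have sη : Summable η := (sb'.mul_right M).add sδ'
  have hMn : 0 ≤ M := (ha0 0).trans (hbd2 0)
  have hη0 : ∀ n, 0 ≤ η n := fun n => add_nonneg (mul_nonneg (hb0 n) hMn) (hδ0 n)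
  have hstep : ∀ n, a' (n + 1) ≤ a' n + η n := by
    intro n
    have := h' n
    have := mul_le_mul_of_nonneg_left (hbd2 n) (hb0 n)
    simp only [hη]
    linarith
  have hanti : Antitone (fun n => a' n - ∑ k ∈ Finset.range n, η k) := by
    apply antitone_nat_of_succ_le
    intro n
    rw [Finset.sum_range_succ]
    linarith [hstep n]
  have hbb : BddBelow (Set.range (fun n => a' n - ∑ k ∈ Finset.range n, η k)) := by
    refine ⟨-∑' k, η k, ?_⟩
    rintro _ ⟨n, rfl⟩
    have := sη.sum_le_tsum (Finset.range n) (fun k _ => hη0 k)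
    simp only
    linarith [ha0 n]
  have t1 := tendsto_atTop_ciInf hanti hbb
  have t2 := sη.hasSum.tendsto_sum_nat
  have t3 := t1.add t2
  simp only [sub_add_cancel] at t3
  exact ⟨_, (tendsto_add_atTop_iff_nat N).1 t3⟩

lemma weighted_cesaro {l s : ℕ → ℝ} (hl : ∀ n, 0 < l n)
    (hd : Tendsto (fun N => ∑ k ∈ Finset.range N, l k) atTop atTop) {c : ℝ}
    (hs : Tendsto s atTop (𝓝 c)) :
    Tendsto (fun n => (∑ k ∈ Finset.range (n + 1), l k)⁻¹ * ∑ k ∈ Finset.range (n + 1), l k * s k)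
      atTop (𝓝 c) := by
  have h0 : (fun n => l n * (s n - c)) =o[atTop] l := by
    have h1 : (fun n => s n - c) =o[atTop] (fun _ => (1 : ℝ)) := by
      rw [Asymptotics.isLittleO_one_iff]
      simpa using hs.sub_const c
    simpa using (Asymptotics.isBigO_refl l atTop).mul_isLittleO h1
  have h1 := h0.sum_range (fun n => (hl n).le) hd
  have h2 := h1.tendsto_div_nhds_zero
  have h3 := ((tendsto_add_atTop_iff_nat 1).2 h2).add_const c
  rw [zero_add] at h3
  refine h3.congr fun n => ?_
  have hp : 0 < ∑ k ∈ Finset.range (n + 1), l k :=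
    Finset.sum_pos (fun k _ => hl k) (by simp)
  simp only [mul_sub, Finset.sum_sub_distrib, ← Finset.sum_mul]
  field_simp
  ring

lemma ultra_weak {z : ℕ → H} {R : ℝ} (hz : ∀ n, ‖z n‖ ≤ R) (U : Ultrafilter ℕ) :
    ∃ p : H, ∀ y, Tendsto (fun n => ⟪z n, y⟫) U (𝓝 ⟪p, y⟫) := by
  let F : ℕ → WeakDual ℝ H := fun n => StrongDual.toWeakDual (InnerProductSpace.toDual ℝ H (z n))
  have hc := WeakDual.isCompact_closedBall (𝕜 := ℝ) (E := H) 0 R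
  obtain ⟨f, -, hf⟩ := hc.ultrafilter_le_nhds (U.map F) (by
    rw [le_principal_iff]
    refine Ultrafilter.mem_map.2 (Filter.mem_of_superset Filter.univ_mem ?_)
    intro n _
    simp [F, hz n])
  refine ⟨(InnerProductSpace.toDual ℝ H).symm (WeakDual.toStrongDual f), fun y => ?_⟩
  have h1 : Tendsto (fun g : WeakDual ℝ H => g y) (𝓝 f) (𝓝 (f y)) :=
    (WeakDual.eval_continuous y).tendsto f
  have h2 : Tendsto F U (𝓝 f) := hf
  have h3 := h1.comp h2
  rw [InnerProductSpace.toDual_symm_apply]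
  exact h3

lemma max_mem {T : H → Set H} (hT : MaxMonotoneOp T) {z w : H}
    (h : ∀ u w', w' ∈ T u → 0 ≤ ⟪w - w', z - u⟫) : w ∈ T z := by
  have := hT.2 (fun x => T x ∪ {v | x = z ∧ v = w}) (by
    rintro x y x' y' (hx | ⟨rfl, rfl⟩) (hy | ⟨rfl, rfl⟩)
    · exact hT.1 x y x' y' hx hy
    · have := h x x' hx
      rw [← neg_sub, ← neg_sub y x, inner_neg_neg]
      exact this
    · exact h y y' hy
    · simp) (fun x => Set.subset_union_left)
  rw [← this]
  exact Or.inr ⟨rfl, rfl⟩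

lemma pen {f : H → ℝ} {g : H → H} {L : ℝ} (hf : ConvexOn ℝ Set.univ f)
    (hg : ∀ p, HasGradientAt f (g p) p) (hL : ∀ p q, ‖g p - g q‖ ≤ L * ‖p - q‖)
    (h0 : ∀ p, 0 ≤ f p) {u : H} (hu : f u = 0) {s γ θ : ℝ} (hs : 0 ≤ s) (hsL : L * s ≤ γ)
    (hθ : 0 ≤ θ) (hθ1 : θ ≤ 1) (hγ : γ * (1 + θ) / 2 ≤ 1 - θ) (x d : H) :
    2 * θ * s * f (x + d) - (1 - θ) * ‖d‖ ^ 2 ≤ 2 * s * ⟪g x, x + d - u⟫ := by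
  have hgu : g u = 0 := by
    have hm : IsLocalMin f u := Filter.Eventually.of_forall fun y => by rw [hu]; exact h0 y
    have := hm.hasFDerivAt_eq_zero (hg u).hasFDerivAt
    simpa using this
  have A : f (x + d) - L / 2 * ‖d‖ ^ 2 ≤ ⟪g x, x + d - u⟫ := by
    have h1 := descent hg hL x (x + d)
    have h2 := grad_ineq hf hg x u
    have e : ⟪g x, x + d - u⟫ = ⟪g x, x + d - x⟫ - ⟪g x, u - x⟫ := by
      rw [← inner_sub_right]; congr 1; abel
    rw [add_sub_cancel_left] at h1 e
    linarith
  have B : - (L / 4 * ‖d‖ ^ 2) ≤ ⟪g x, x + d - u⟫ := by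
    have h1 := descent hg hL x (x + (1 / 2 : ℝ) • d)
    have h2 := descent hg hL u (u - (1 / 2 : ℝ) • d)
    have h3 := grad_ineq hf hg x (u - (1 / 2 : ℝ) • d)
    have h4 := h0 (x + (1 / 2 : ℝ) • d)
    rw [hgu, hu, inner_zero_left] at h2
    have n1 : ‖x + (1 / 2 : ℝ) • d - x‖ ^ 2 = ‖d‖ ^ 2 / 4 := by
      rw [add_sub_cancel_left, norm_smul, Real.norm_of_nonneg (by norm_num)]; ring
    have n2 : ‖u - (1 / 2 : ℝ) • d - u‖ ^ 2 = ‖d‖ ^ 2 / 4 := by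
      rw [sub_sub_cancel_left, norm_neg, norm_smul, Real.norm_of_nonneg (by norm_num)]; ring
    rw [n1] at h1
    rw [n2] at h2
    have e : ⟪g x, x + d - u⟫ = ⟪g x, x + (1 / 2 : ℝ) • d - x⟫ -
        ⟪g x, u - (1 / 2 : ℝ) • d - x⟫ := by
      rw [← inner_sub_right]; congr 1; module
    linarith
  have hd := sq_nonneg ‖d‖
  have C1 := mul_le_mul_of_nonneg_left A (mul_nonneg hs hθ)
  have C2 := mul_le_mul_of_nonneg_left B (mul_nonneg hs (sub_nonneg.2 hθ1))
  have C3 : L * s * (1 + θ) / 2 ≤ 1 - θ := by nlinarith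
  have C4 := mul_le_mul_of_nonneg_right C3 hd
  nlinarith

lemma psi_zero (d : SFBP H) {u : H} (hu : u ∈ d.C) : d.Ψ₁ u = 0 ∧ d.Ψ₂ u = 0 := by
  rw [d.Cdef] at hu
  obtain ⟨p, hp⟩ := d.minΨ₁
  obtain ⟨q, hq⟩ := d.minΨ₂
  exact ⟨le_antisymm (hp ▸ hu.1 p) (d.Ψ₁nonneg u), le_antisymm (hq ▸ hu.2 q) (d.Ψ₂nonneg u)⟩

lemma key_real (d : SFBP H) {u z : H} (hz : z ∈ nCone d.C u) :
    ∃ e : ℕ → ℝ, (∀ n, 0 ≤ e n) ∧ Summable e ∧ ∀ n y (r : ℝ), d.Ψ₂ y = (r : EReal) →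
      d.lam n * ⟪z, y - u⟫ - d.lam n * d.beta n * (d.Ψ₁ y + r) ≤ e n := by
  obtain ⟨M, hM⟩ := d.keyCond z ⟨u, hz⟩
  obtain ⟨huC, hzC⟩ := hz
  obtain ⟨hu1, hu2⟩ := psi_zero d huC
  set G : ℕ → EReal := fun n =>
    fenchelConj (fun q => ((d.Ψ₁ q : ℝ) : EReal) + d.Ψ₂ q) ((d.beta n)⁻¹ • z)
          - suppFun d.C ((d.beta n)⁻¹ • z) with hG
  set T : ℕ → EReal := fun n => (((d.lam n * d.beta n : ℝ)) : EReal) * G n with hT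
  have hM' : ∀ N, ∑ n ∈ Finset.range N, T n ≤ (M : EReal) := hM
  have hsupp : ∀ n, suppFun d.C ((d.beta n)⁻¹ • z) = ((⟪(d.beta n)⁻¹ • z, u⟫ : ℝ) : EReal) := by
    intro n
    apply le_antisymm
    · refine iSup_le fun c => ?_
      rw [EReal.coe_le_coe_iff, inner_smul_left, inner_smul_left]
      have := hzC c c.2
      rw [inner_sub_right] at this
      exact mul_le_mul_of_nonneg_left (by linarith) (by simpa using (d.betaPos n).le)
    · exact le_iSup (fun c : d.C => ((⟪(d.beta n)⁻¹ • z, (c : H)⟫ : ℝ) : EReal)) ⟨u, huC⟩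
  have hlow : ∀ n y (r : ℝ), d.Ψ₂ y = (r : EReal) →
      ((⟪(d.beta n)⁻¹ • z, y - u⟫ - (d.Ψ₁ y + r) : ℝ) : EReal) ≤ G n := by
    intro n y r hr
    have h1 := le_iSup (fun y => (((⟪y, (d.beta n)⁻¹ • z⟫ : ℝ) : EReal) -
      (((d.Ψ₁ y : ℝ) : EReal) + d.Ψ₂ y))) y
    simp only [hG]
    rw [hsupp]
    refine le_trans (le_of_eq ?_) (EReal.sub_le_sub h1 le_rfl)
    simp only [hr]
    rw [← EReal.coe_add, ← EReal.coe_sub, ← EReal.coe_sub, inner_sub_right, real_inner_comm y]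
    congr 1
    ring
  have hlb : ∀ n, 0 < d.lam n * d.beta n := fun n => mul_pos (d.lamPos n) (d.betaPos n)
  have hG0 : ∀ n, 0 ≤ G n := by
    intro n
    have := hlow n u 0 (by simpa using hu2)
    simpa [hu1] using this
  have hT0 : ∀ n, 0 ≤ T n := fun n =>
    EReal.mul_nonneg (by exact_mod_cast (hlb n).le) (hG0 n)
  have hTtop : ∀ n, T n ≠ ⊤ := by
    intro n h
    have h1 : T n ≤ (M : EReal) := (Finset.single_le_sum (f := T) (fun k _ => hT0 k)
      (Finset.self_mem_range_succ n)).trans (hM' (n + 1))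
    rw [h] at h1
    exact absurd h1 (by simp)
  have hTbot : ∀ n, T n ≠ ⊥ := fun n h => by have := hT0 n; rw [h] at this; simp at this
  have hTc : ∀ n, ((T n).toReal : EReal) = T n := fun n => EReal.coe_toReal (hTtop n) (hTbot n)
  refine ⟨fun n => (T n).toReal, fun n => EReal.toReal_nonneg (hT0 n), ?_, ?_⟩
  · refine summable_of_sum_range_le (c := M) (fun n => EReal.toReal_nonneg (hT0 n)) fun N => ?_
    rw [← EReal.coe_le_coe_iff]
    refine le_trans (le_of_eq ?_) (hM' N)
    induction N with
    | zero => simp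
    | succ N ih => rw [Finset.sum_range_succ, Finset.sum_range_succ, EReal.coe_add, ih, hTc]
  · intro n y r hr
    rw [← EReal.coe_le_coe_iff, hTc]
    have h1 : (((d.lam n * d.beta n : ℝ)) : EReal) *
      ((⟪(d.beta n)⁻¹ • z, y - u⟫ - (d.Ψ₁ y + r) : ℝ) : EReal) ≤ T n :=
      mul_le_mul_of_nonneg_left (hlow n y r hr) (by exact_mod_cast (hlb n).le)
    refine le_trans (le_of_eq ?_) h1
    rw [← EReal.coe_mul, inner_smul_left]
    congr 1
    have := (d.betaPos n).ne'
    simp only [RCLike.conj_to_real]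
    field_simp

lemma main_ineq (d : SFBP H) (hl2 : Summable fun n => d.lam n ^ 2) {u v p : H}
    (hv : v ∈ d.A u) (hp : p ∈ nCone d.C u) :
    ∃ (c : ℝ) (δ : ℕ → ℝ) (N : ℕ), 0 ≤ c ∧ (∀ n, 0 ≤ δ n) ∧ Summable δ ∧ ∀ n ≥ N,
      ‖d.x (n + 1) - u‖ ^ 2 + 2 * d.lam n * ⟪v + d.Φ' u + p, d.x n - u⟫ ≤
        (1 + c * d.lam n ^ 2) * ‖d.x n - u‖ ^ 2 + δ n := by
  obtain ⟨γ0, hγ0, hev⟩ := d.limsupCond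
  obtain ⟨N, hN⟩ := eventually_atTop.1 hev
  set γ := max γ0 0 with hγ
  have hγ2 : γ < 2 := max_lt hγ0 two_pos
  have hγn : 0 ≤ γ := le_max_right _ _
  set θ := (2 - γ) / 4 with hθd
  have hθ : 0 < θ := by rw [hθd]; linarith
  have hθ1 : θ ≤ 1 := by rw [hθd]; linarith
  have hγθ : γ * (1 + θ) / 2 ≤ 1 - θ := by
    have : γ = 2 - 4 * θ := by rw [hθd]; ring
    rw [this]; nlinarith
  have hz : θ⁻¹ • p ∈ nCone d.C u := by
    refine ⟨hp.1, fun c hc => ?_⟩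
    rw [inner_smul_left]
    exact mul_nonpos_of_nonneg_of_nonpos (by simpa using hθ.le) (hp.2 c hc)
  obtain ⟨e, he0, hes, he⟩ := key_real d hz
  obtain ⟨hu1, hu2⟩ := psi_zero d hp.1
  set w := v + d.Φ' u + p with hw
  set K := d.LΦ with hK
  refine ⟨2 / θ * K ^ 2, fun n => 2 / θ * ‖w‖ ^ 2 * d.lam n ^ 2 + 2 * θ * e n, N, by positivity,
    fun n => ?_, (hl2.mul_left _).add (hes.mul_left _), fun n hn => ?_⟩
  · have := he0 n
    positivity
  obtain ⟨a, ha, ξ, hξ, hx⟩ := d.algo n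
  have hl := d.lamPos n
  have hb := d.betaPos n
  set l := d.lam n with hldef
  set b := d.beta n with hbdef
  set X := d.x n with hX
  set Y := d.x (n + 1) with hY
  set D := Y - X with hD
  -- finiteness of the nonsmooth penalization
  have hξu := hξ u
  rw [hu2] at hξu
  have hne : d.Ψ₂ Y ≠ ⊤ := by
    intro h
    rw [h, EReal.top_add_coe] at hξu
    simp at hξu
  obtain ⟨r, hr⟩ : ∃ r : ℝ, d.Ψ₂ Y = (r : EReal) :=
    ⟨_, (EReal.coe_toReal hne (d.properΨ₂.2.1 Y)).symm⟩
  have hr0 : 0 ≤ r := by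
    have := d.Ψ₂nonneg Y
    rw [hr] at this
    exact_mod_cast this
  have Iξ : r ≤ ⟪ξ, Y - u⟫ := by
    rw [hr, ← EReal.coe_add, ← EReal.coe_zero, EReal.coe_le_coe_iff] at hξu
    rw [← neg_sub, inner_neg_right]
    linarith
  have I0 : ‖Y - u‖ ^ 2 = ‖X - u‖ ^ 2 - ‖D‖ ^ 2 - 2 * l * ⟪d.Φ' X, Y - u⟫
      - 2 * (l * b) * ⟪d.Ψ₁' X, Y - u⟫ - 2 * l * ⟪a, Y - u⟫ - 2 * (l * b) * ⟪ξ, Y - u⟫ := by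
    have h1 : ‖X - u‖ ^ 2 = ‖Y - u‖ ^ 2 + 2 * ⟪X - Y, Y - u⟫ + ‖D‖ ^ 2 := by
      have : X - u = (Y - u) + (X - Y) := by abel
      rw [this, norm_add_sq_real, real_inner_comm, hD, norm_sub_rev Y X]
    have h2 : ⟪X - Y, Y - u⟫ = l * (⟪d.Φ' X, Y - u⟫ + b * ⟪d.Ψ₁' X, Y - u⟫ + ⟪a, Y - u⟫
        + b * ⟪ξ, Y - u⟫) := by
      rw [hx]
      simp only [inner_smul_left, inner_add_left, RCLike.conj_to_real]
    rw [h2] at h1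
    linarith
  have Ia : ⟪v, Y - u⟫ ≤ ⟪a, Y - u⟫ := by
    have := d.maxmonA.1 _ _ _ _ ha hv
    rw [inner_sub_left] at this
    linarith
  have hXD : X + D = Y := by rw [hD]; abel
  have Ig : 2 * θ * (l * b) * d.Ψ₁ Y - (1 - θ) * ‖D‖ ^ 2 ≤ 2 * (l * b) * ⟪d.Ψ₁' X, Y - u⟫ := by
    have := pen d.convΨ₁ d.gradΨ₁ d.lipΨ₁ d.Ψ₁nonneg hu1 (mul_pos hl hb).le
      ((hN n hn).trans (le_max_left γ0 0)) hθ.le hθ1 hγθ X D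
    rwa [hXD] at this
  have Iφ1 : 0 ≤ ⟪d.Φ' X - d.Φ' u, X - u⟫ := by
    have h1 := grad_ineq d.convΦ d.gradΦ X u
    have h2 := grad_ineq d.convΦ d.gradΦ u X
    rw [inner_sub_left]
    rw [← neg_sub, inner_neg_right] at h1
    linarith
  have Iφ2 : -(K * ‖X - u‖ * ‖D‖) ≤ ⟪d.Φ' X - d.Φ' u, D⟫ := by
    have h1 := (abs_le.1 (abs_real_inner_le_norm (d.Φ' X - d.Φ' u) D)).1
    have h2 := mul_le_mul_of_nonneg_right (d.lipΦ X u) (norm_nonneg D)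
    linarith
  have hYu : Y - u = (X - u) + D := by rw [hD]; abel
  have Iφ3 : ⟪d.Φ' X, Y - u⟫ = ⟪d.Φ' X - d.Φ' u, X - u⟫ + ⟪d.Φ' X - d.Φ' u, D⟫
      + ⟪d.Φ' u, Y - u⟫ := by
    rw [← inner_add_right, ← hYu, ← inner_add_left, sub_add_cancel]
  have Ik : l * ⟪p, Y - u⟫ ≤ θ * (l * b) * (d.Ψ₁ Y + r) + θ * e n := by
    have := he n Y r hr
    rw [inner_smul_left, RCLike.conj_to_real] at this
    have h2 := mul_le_mul_of_nonneg_left this hθ.le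
    have h3 : θ * (l * (θ⁻¹ * ⟪p, Y - u⟫) - l * b * (d.Ψ₁ Y + r)) =
      l * ⟪p, Y - u⟫ - θ * (l * b) * (d.Ψ₁ Y + r) := by
      field_simp
    linarith
  have Iw : ⟪w, X - u⟫ + ⟪w, D⟫ = ⟪v, Y - u⟫ + ⟪d.Φ' u, Y - u⟫ + ⟪p, Y - u⟫ := by
    rw [← inner_add_right, ← hYu, hw, inner_add_left, inner_add_left]
  have Iw2 : -(‖w‖ * ‖D‖) ≤ ⟪w, D⟫ := (abs_le.1 (abs_real_inner_le_norm w D)).1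
  have Q : ∀ m : ℝ, 2 * l * m * ‖D‖ ≤ θ / 2 * ‖D‖ ^ 2 + 2 / θ * m ^ 2 * l ^ 2 := by
    intro m
    have h1 : 0 ≤ θ / 2 * (‖D‖ - 2 / θ * l * m) ^ 2 := by positivity
    have h2 : θ / 2 * (‖D‖ - 2 / θ * l * m) ^ 2 =
      θ / 2 * ‖D‖ ^ 2 + 2 / θ * m ^ 2 * l ^ 2 - 2 * l * m * ‖D‖ := by
      field_simp
      ring
    linarith
  have Q1 := Q (K * ‖X - u‖)
  have Q2 := Q ‖w‖
  have m1 := mul_le_mul_of_nonneg_left Ia hl.le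
  have m2 := mul_le_mul_of_nonneg_left Iξ (mul_pos hl hb).le
  have m3 := mul_le_mul_of_nonneg_left Iφ1 hl.le
  have m4 := mul_le_mul_of_nonneg_left Iφ2 hl.le
  have m5 := mul_le_mul_of_nonneg_left Iw2 hl.le
  have m6 : 0 ≤ (1 - θ) * (l * b * r) :=
    mul_nonneg (by linarith) (mul_nonneg (mul_pos hl hb).le hr0)
  have m7 := congrArg (fun t => l * t) Iw
  have m8 := congrArg (fun t => l * t) Iφ3
  beta_reduce at m7 m8
  linarith

lemma fejer (d : SFBP H) (hl2 : Summable fun n => d.lam n ^ 2) {u : H} (hu : u ∈ d.S) :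
    ∃ l, Tendsto (fun n => ‖d.x n - u‖ ^ 2) atTop (𝓝 l) := by
  obtain ⟨v, hv, p, hp, h0⟩ := hu
  obtain ⟨c, δ, N, hc, hδ, sδ, h⟩ := main_ineq d hl2 hv hp
  refine quasi_fejer (b := fun n => c * d.lam n ^ 2) (δ := δ) (fun n => by positivity)
    (fun n => by positivity) hδ (hl2.mul_left c) sδ N fun n hn => ?_
  have := h n hn
  rw [h0, inner_zero_left] at this
  linarith

end SFBPaux

/-- **Theorem 2.1, part 2.** Under hypotheses (H₀) and `(λ_n) ∈ ℓ²`, the averaged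
sequence `z_n = τ_n⁻¹ ∑_{k≤n} λ_k x_k` converges weakly to a point of `S`. -/
theorem sfbp_weak_ergodic_z (d : SFBP H) (hl2 : Summable fun n => d.lam n ^ 2) :
    ∃ p ∈ d.S, WeakConv (fun n =>
      (∑ k ∈ Finset.range (n + 1), d.lam k)⁻¹ •
        ∑ k ∈ Finset.range (n + 1), d.lam k • d.x k) p := by
  set Z : ℕ → H := fun n => (∑ k ∈ Finset.range (n + 1), d.lam k)⁻¹ •
        ∑ k ∈ Finset.range (n + 1), d.lam k • d.x k with hZ
  have hτ : ∀ n, 0 < ∑ k ∈ Finset.range (n + 1), d.lam k := fun n =>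
    Finset.sum_pos (fun k _ => d.lamPos k) (by simp)
  have hZin : ∀ n y, ⟪Z n, y⟫ = (∑ k ∈ Finset.range (n + 1), d.lam k)⁻¹ *
      ∑ k ∈ Finset.range (n + 1), d.lam k * ⟪d.x k, y⟫ := by
    intro n y
    simp only [hZ, inner_smul_left, sum_inner, RCLike.conj_to_real]
  -- boundedness
  obtain ⟨u0, hu0⟩ : ∃ u0, u0 ∈ d.S := d.Sne
  obtain ⟨R, hR⟩ : ∃ R, ∀ n, ‖d.x n‖ ≤ R := by
    obtain ⟨l, hl⟩ := SFBPaux.fejer d hl2 hu0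
    obtain ⟨B, hB⟩ := hl.bddAbove_range
    refine ⟨‖u0‖ + (B + 1), fun n => ?_⟩
    have h1 : ‖d.x n - u0‖ ^ 2 ≤ B := hB ⟨n, rfl⟩
    have h2 : ‖d.x n‖ ≤ ‖d.x n - u0‖ + ‖u0‖ := by
      simpa using norm_add_le (d.x n - u0) u0
    nlinarith [sq_nonneg (‖d.x n - u0‖ - 1)]
  have hZR : ∀ n, ‖Z n‖ ≤ R := by
    intro n
    simp only [hZ]
    rw [norm_smul, Real.norm_of_nonneg (inv_nonneg.2 (hτ n).le), inv_mul_le_iff₀ (hτ n),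
      Finset.sum_mul]
    refine (norm_sum_le _ _).trans (Finset.sum_le_sum fun k _ => ?_)
    rw [norm_smul, Real.norm_of_nonneg (d.lamPos k).le]
    exact mul_le_mul_of_nonneg_left (hR k) (d.lamPos k).le
  -- asymptotic inequality against the graph of `T`
  have hasym : ∀ u v p, v ∈ d.A u → p ∈ nCone d.C u → ∃ M : ℝ, ∀ᶠ n in atTop,
      ⟪Z n, v + d.Φ' u + p⟫ - ⟪u, v + d.Φ' u + p⟫ ≤
        (∑ k ∈ Finset.range (n + 1), d.lam k)⁻¹ * M := by
    intro u v p hv hp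
    obtain ⟨c, δ, N, hc, hδ, sδ, h⟩ := SFBPaux.main_ineq d hl2 hv hp
    set w := v + d.Φ' u + p with hw
    set B := (R + ‖u‖) ^ 2 with hB
    have hxB : ∀ n, ‖d.x n - u‖ ^ 2 ≤ B := fun n => by
      have := (norm_sub_le (d.x n) u).trans (add_le_add_left (hR n) ‖u‖)
      exact pow_le_pow_left₀ (norm_nonneg _) this 2
    set η : ℕ → ℝ := fun n => c * B * d.lam n ^ 2 + δ n with hη
    have sη : Summable η := (hl2.mul_left _).add sδ
    have hη0 : ∀ n, 0 ≤ η n := fun n => add_nonneg (by positivity) (hδ n)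
    set s : ℕ → ℝ := fun n => 2 * d.lam n * ⟪w, d.x n - u⟫ with hs
    have hstep : ∀ n ≥ N, ‖d.x (n + 1) - u‖ ^ 2 + s n ≤ ‖d.x n - u‖ ^ 2 + η n := by
      intro n hn
      have h1 := h n hn
      have h2 := mul_le_mul_of_nonneg_left (hxB n) (mul_nonneg hc (sq_nonneg (d.lam n)))
      simp only [hs, hη]
      linarith
    set C0 := ∑ k ∈ Finset.range N, s k + ‖d.x N - u‖ ^ 2 with hC0
    have hsum : ∀ n, ∑ k ∈ Finset.range (N + n), s k + ‖d.x (N + n) - u‖ ^ 2 ≤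
        C0 + ∑ k ∈ Finset.range (N + n), η k := by
      intro n
      induction n with
      | zero =>
        have := Finset.sum_nonneg (s := Finset.range N) (fun k _ => hη0 k)
        simp only [add_zero]
        linarith
      | succ n ih =>
        rw [← add_assoc, Finset.sum_range_succ, Finset.sum_range_succ]
        have := hstep (N + n) (by omega)
        linarith
    refine ⟨(C0 + ∑' k, η k) / 2, eventually_atTop.2 ⟨N, fun n hn => ?_⟩⟩
    have h1 : ∑ k ∈ Finset.range (n + 1), s k ≤ C0 + ∑' k, η k := by
      obtain ⟨m, hm⟩ := Nat.exists_eq_add_of_le (show N ≤ n + 1 by omega)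
      have h2 := hsum m
      rw [← hm] at h2
      have h3 := sη.sum_le_tsum (Finset.range (n + 1)) (fun k _ => hη0 k)
      have := sq_nonneg ‖d.x (n + 1) - u‖
      linarith
    have h2 : ∑ k ∈ Finset.range (n + 1), s k = 2 * (∑ k ∈ Finset.range (n + 1),
        d.lam k * ⟪d.x k, w⟫ - (∑ k ∈ Finset.range (n + 1), d.lam k) * ⟪u, w⟫) := by
      rw [Finset.sum_mul, ← Finset.sum_sub_distrib, Finset.mul_sum]
      refine Finset.sum_congr rfl fun k _ => ?_
      simp only [hs]
      rw [inner_sub_right, real_inner_comm w, real_inner_comm w]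
      ring
    have h3 : ⟪Z n, w⟫ - ⟪u, w⟫ = (∑ k ∈ Finset.range (n + 1), d.lam k)⁻¹ *
        (∑ k ∈ Finset.range (n + 1),
        d.lam k * ⟪d.x k, w⟫ - (∑ k ∈ Finset.range (n + 1), d.lam k) * ⟪u, w⟫) := by
      rw [hZin, mul_sub, inv_mul_cancel_left₀ (hτ n).ne']
    rw [h3]
    exact mul_le_mul_of_nonneg_left (by linarith) (inv_nonneg.2 (hτ n).le)
  have hτinv : Tendsto (fun n => (∑ k ∈ Finset.range (n + 1), d.lam k)⁻¹) atTop (𝓝 0) :=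
    ((tendsto_add_atTop_iff_nat 1).2 d.lamDiv).inv_tendsto_atTop
  -- every weak limit along an ultrafilter is a solution
  have hlimS : ∀ (U : Ultrafilter ℕ) (q : H), (U : Filter ℕ) ≤ atTop →
      (∀ y, Tendsto (fun n => ⟪Z n, y⟫) U (𝓝 ⟪q, y⟫)) → q ∈ d.S := by
    intro U q hU hq
    have h0 := SFBPaux.max_mem d.maxmonT (z := q) (w := 0) (by
      rintro u w ⟨v, hv, p, hp, rfl⟩
      obtain ⟨M, hM⟩ := hasym u v p hv hp
      have t1 := (hq (v + d.Φ' u + p)).sub_const ⟪u, v + d.Φ' u + p⟫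
      have t2 := (hτinv.mul_const M).mono_left hU
      have := le_of_tendsto_of_tendsto t1 t2 (hM.filter_mono hU)
      rw [zero_sub, inner_neg_left, real_inner_comm, inner_sub_left]
      linarith)
    obtain ⟨za, hza, v, hv, h⟩ := h0
    exact ⟨za, hza, v, hv, h.symm⟩
  have huniq : ∀ (U V : Ultrafilter ℕ) (p q : H), (U : Filter ℕ) ≤ atTop →
      (V : Filter ℕ) ≤ atTop → (∀ y, Tendsto (fun n => ⟪Z n, y⟫) U (𝓝 ⟪p, y⟫)) →
      (∀ y, Tendsto (fun n => ⟪Z n, y⟫) V (𝓝 ⟪q, y⟫)) → p = q := by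
    intro U V p q hU hV hp hq
    obtain ⟨l1, h1⟩ := SFBPaux.fejer d hl2 (hlimS U p hU hp)
    obtain ⟨l2, h2⟩ := SFBPaux.fejer d hl2 (hlimS V q hV hq)
    have h3 : Tendsto (fun n => ⟪d.x n, p - q⟫) atTop
        (𝓝 ((l2 - l1 + (‖p‖ ^ 2 - ‖q‖ ^ 2)) / 2)) := by
      refine (((h2.sub h1).add_const (‖p‖ ^ 2 - ‖q‖ ^ 2)).div_const 2).congr fun n => ?_
      rw [norm_sub_sq_real, norm_sub_sq_real, inner_sub_right]
      ring
    have h4 := SFBPaux.weighted_cesaro d.lamPos d.lamDiv h3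
    have h5 := h4.congr (fun n => (hZin n (p - q)).symm)
    have e1 := tendsto_nhds_unique (hp (p - q)) (h5.mono_left hU)
    have e2 := tendsto_nhds_unique (hq (p - q)) (h5.mono_left hV)
    rw [← sub_eq_zero, ← inner_self_eq_zero (𝕜 := ℝ), inner_sub_left, e1, e2, sub_self]
  obtain ⟨p, hp⟩ := SFBPaux.ultra_weak hZR (Ultrafilter.of atTop)
  refine ⟨p, hlimS _ p (Ultrafilter.of_le _) hp, fun y => ?_⟩
  rw [tendsto_iff_ultrafilter]
  intro V hV
  obtain ⟨q, hq⟩ := SFBPaux.ultra_weak hZR V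
  rw [huniq _ V p q (Ultrafilter.of_le _) hV hp hq]
  exact hq y
end

section
/- (Theorem 2.2, strongly convex case) Assume hypotheses (H₀) and that Φ is strongly convex with parameter α > 0, i.e. ⟨∇Φ(x) − ∇Φ(y), x − y⟩ ≥ α‖x − y‖² for all x, y ∈ H. Then S consists of a single point u, and every sequence (x_n) generated by the (SFBP) algorithm converges strongly (in norm) to u as n → ∞. -/
open Filter Topology
open scoped RealInnerProductSpace

variable {H : Type*} [NormedAddCommGroup H] [InnerProductSpace ℝ H] [CompleteSpace H]

lemma sfbp_hasDeriv {f : H → ℝ} {f' : H → H} (hf : ∀ p, HasGradientAt f (f' p) p)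
    (x v : H) (t : ℝ) :
    HasDerivAt (fun t : ℝ => f (x + t • v)) ⟪f' (x + t • v), v⟫ t := by
  have h1 : HasDerivAt (fun t : ℝ => x + t • v) v t := by
    simpa using ((hasDerivAt_id t).smul_const v).const_add x
  have h2 := (hf (x + t • v)).hasFDerivAt.comp_hasDerivAt t h1
  exact h2.congr_deriv (by simp [InnerProductSpace.toDual_apply_apply])

lemma sfbp_grad_ineq {f : H → ℝ} {f' : H → H} (hc : ConvexOn ℝ Set.univ f)
    (hf : ∀ p, HasGradientAt f (f' p) p) (x y : H) :
    f x + ⟪f' x, y - x⟫ ≤ f y := by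
  have hd := sfbp_hasDeriv hf x (y - x) 0
  have hcv : ConvexOn ℝ Set.univ (fun t : ℝ => f (x + t • (y - x))) := by
    refine ⟨convex_univ, fun s _ t _ a b ha hb hab => ?_⟩
    have := hc.2 (Set.mem_univ (x + s • (y - x))) (Set.mem_univ (x + t • (y - x))) ha hb hab
    refine le_trans (le_of_eq ?_) this
    change f (x + (a • s + b • t) • (y - x)) = _
    congr 1
    have : b = 1 - a := by linarith
    subst this
    simp only [smul_eq_mul]
    module
  have := hcv.le_slope_of_hasDerivAt (Set.mem_univ 0) (Set.mem_univ 1) one_pos hd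
  simp [slope_def_field] at this
  linarith

lemma sfbp_descent {f : H → ℝ} {f' : H → H} {L : ℝ}
    (hf : ∀ p, HasGradientAt f (f' p) p)
    (hL : ∀ p q, ‖f' p - f' q‖ ≤ L * ‖p - q‖) (x v : H) :
    f (x + v) ≤ f x + ⟪f' x, v⟫ + L / 2 * ‖v‖ ^ 2 := by
  have hd : ∀ t : ℝ, HasDerivAt
      (fun t : ℝ => f (x + t • v) - t * ⟪f' x, v⟫ - t ^ 2 * (L / 2 * ‖v‖ ^ 2))
      (⟪f' (x + t • v), v⟫ - ⟪f' x, v⟫ - (2 * t) * (L / 2 * ‖v‖ ^ 2)) t := by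
    intro t
    have h := ((sfbp_hasDeriv hf x v t).sub ((hasDerivAt_id t).mul_const ⟪f' x, v⟫)).sub
      (((hasDerivAt_id t).pow 2).mul_const (L / 2 * ‖v‖ ^ 2))
    refine h.congr_deriv ?_
    simp
  have hanti : AntitoneOn
      (fun t : ℝ => f (x + t • v) - t * ⟪f' x, v⟫ - t ^ 2 * (L / 2 * ‖v‖ ^ 2)) (Set.Icc 0 1) := by
    refine antitoneOn_of_deriv_nonpos (convex_Icc 0 1)
      (fun t _ => (hd t).continuousAt.continuousWithinAt)
      (fun t _ => (hd t).differentiableAt.differentiableWithinAt) ?_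
    intro t ht
    rw [interior_Icc] at ht
    rw [(hd t).deriv, ← inner_sub_left]
    have h1 := real_inner_le_norm (f' (x + t • v) - f' x) v
    have h2 := hL (x + t • v) x
    rw [add_sub_cancel_left, norm_smul, Real.norm_eq_abs, abs_of_pos ht.1] at h2
    have h3 := mul_le_mul_of_nonneg_right h2 (norm_nonneg v)
    nlinarith
  have := hanti (Set.left_mem_Icc.2 zero_le_one) (Set.right_mem_Icc.2 zero_le_one) zero_le_one
  simp at this
  linarith

/-- real sequence lemma -/
lemma sfbp_seq {a l δ e : ℕ → ℝ} {c : ℝ} (hc : 0 < c) (ha : ∀ n, 0 ≤ a n) (hl : ∀ n, 0 ≤ l n)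
    (hδ0 : ∀ n, 0 ≤ δ n) (he0 : ∀ n, 0 ≤ e n) (hδ : Summable δ) (he : Summable e)
    (hdiv : ¬ Summable l)
    (h : ∀ n, a (n + 1) ≤ a n - c * l n * a n + δ n * a n + e n) :
    Tendsto a atTop (𝓝 0) := by
  have hb : ∀ n, a n ≤ Real.exp (∑ k ∈ Finset.range n, δ k) *
      (a 0 + ∑ k ∈ Finset.range n, e k) := by
    intro n
    induction n with
    | zero => simp
    | succ n ih =>
      rw [Finset.sum_range_succ, Finset.sum_range_succ, Real.exp_add]
      set D := ∑ k ∈ Finset.range n, δ k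
      set E := ∑ k ∈ Finset.range n, e k
      have hD : 0 ≤ D := Finset.sum_nonneg fun k _ => hδ0 k
      have h1 : 1 + δ n ≤ Real.exp (δ n) := by linarith [Real.add_one_le_exp (δ n)]
      have h2 : 1 ≤ Real.exp D := Real.one_le_exp hD
      have h3 : 1 ≤ Real.exp (δ n) := Real.one_le_exp (hδ0 n)
      have h4 : a (n + 1) ≤ (1 + δ n) * a n + e n := by
        have := mul_nonneg (mul_nonneg hc.le (hl n)) (ha n)
        linarith [h n]
      have h5 : (1 + δ n) * a n ≤ Real.exp (δ n) * (Real.exp D * (a 0 + E)) :=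
        mul_le_mul h1 ih (ha n) (by positivity)
      have h6 : e n ≤ Real.exp D * Real.exp (δ n) * e n :=
        le_mul_of_one_le_left (he0 n) (one_le_mul_of_one_le_of_one_le h2 h3)
      nlinarith
  obtain ⟨K, hK0, hK⟩ : ∃ K, 0 ≤ K ∧ ∀ n, a n ≤ K := by
    refine ⟨Real.exp (∑' k, δ k) * (a 0 + ∑' k, e k), ?_, fun n => (hb n).trans ?_⟩
    · have : 0 ≤ ∑' k, e k := tsum_nonneg he0
      have := ha 0
      positivity
    · have h1 := hδ.sum_le_tsum (Finset.range n) (fun k _ => hδ0 k)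
      have h2 := he.sum_le_tsum (Finset.range n) (fun k _ => he0 k)
      have h3 : 0 ≤ ∑ k ∈ Finset.range n, e k := Finset.sum_nonneg fun k _ => he0 k
      have := ha 0
      gcongr
  set r : ℕ → ℝ := fun n => δ n * K + e n with hr
  have hrs : Summable r := (hδ.mul_right K).add he
  have h' : ∀ n, a (n + 1) ≤ a n - c * l n * a n + r n := fun n => by
    have := mul_le_mul_of_nonneg_left (hK n) (hδ0 n)
    have := h n
    simp only [hr]; linarith
  have hr0 : ∀ n, 0 ≤ r n := fun n => add_nonneg (mul_nonneg (hδ0 n) hK0) (he0 n)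
  have hanti : Antitone fun n => a n - ∑ k ∈ Finset.range n, r k := by
    refine antitone_nat_of_succ_le fun n => ?_
    rw [Finset.sum_range_succ]
    have := mul_nonneg (mul_nonneg hc.le (hl n)) (ha n)
    linarith [h' n]
  have hbdd : BddBelow (Set.range fun n => a n - ∑ k ∈ Finset.range n, r k) := by
    refine ⟨-∑' k, r k, ?_⟩
    rintro _ ⟨n, rfl⟩
    have := hrs.sum_le_tsum (Finset.range n) (fun k _ => hr0 k)
    have := ha n
    simp only; linarith
  have hlim := (tendsto_atTop_ciInf hanti hbdd).add hrs.hasSum.tendsto_sum_nat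
  simp only [sub_add_cancel] at hlim
  set ℓ := (⨅ n, (a n - ∑ k ∈ Finset.range n, r k)) + ∑' k, r k with hℓ
  have hℓ0 : 0 ≤ ℓ := ge_of_tendsto' hlim ha
  have hsum : Summable fun n => c * l n * a n := by
    refine summable_of_sum_range_le (c := a 0 + ∑' k, r k)
      (fun n => mul_nonneg (mul_nonneg hc.le (hl n)) (ha n)) fun n => ?_
    have h1 : ∑ k ∈ Finset.range n, c * l k * a k ≤ a 0 - a n + ∑ k ∈ Finset.range n, r k := by
      induction n with
      | zero => simp
      | succ n ih =>
        rw [Finset.sum_range_succ, Finset.sum_range_succ]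
        linarith [h' n]
    have := hrs.sum_le_tsum (Finset.range n) (fun k _ => hr0 k)
    have := ha n
    linarith
  rcases hℓ0.eq_or_lt with h0 | h0
  · rw [h0]; exact hlim
  · exfalso
    apply hdiv
    have hev : ∀ᶠ n in atTop, ℓ / 2 < a n := hlim.eventually (lt_mem_nhds (by linarith))
    obtain ⟨N, hN⟩ := eventually_atTop.1 hev
    rw [← summable_nat_add_iff N]
    rw [← summable_nat_add_iff N] at hsum
    refine Summable.of_nonneg_of_le (fun n => hl _) (fun n => ?_) (hsum.mul_left ((c * (ℓ / 2))⁻¹))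
    have h1 := (hN (n + N) (by omega)).le
    have h2 : 0 < c * (ℓ / 2) := by positivity
    rw [inv_mul_eq_div, le_div_iff₀ h2]
    have := mul_le_mul_of_nonneg_left h1 (mul_nonneg hc.le (hl (n + N)))
    linarith

/-- penalization estimate -/
lemma sfbp_pen {f : H → ℝ} {f' : H → H} {L : ℝ} (hc : ConvexOn ℝ Set.univ f)
    (hf : ∀ p, HasGradientAt f (f' p) p)
    (hL : ∀ p q, ‖f' p - f' q‖ ≤ L * ‖p - q‖) (h0 : ∀ p, 0 ≤ f p)
    {u : H} (hu : f u = 0) (x v : H) {θ : ℝ} (hθ : 0 ≤ θ) (hθ1 : θ ≤ 1) :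
    θ * f (x + v) - (1 + θ) * (L / 4 * ‖v‖ ^ 2) ≤ ⟪f' x, x + v - u⟫ := by
  have hgu : f' u = 0 := by
    have hm : IsLocalMin f u := Filter.Eventually.of_forall fun p => by rw [hu]; exact h0 p
    have := hm.hasFDerivAt_eq_zero (hf u).hasFDerivAt
    simpa using this
  have e1 := sfbp_grad_ineq hc hf x u
  have e2 := sfbp_descent hf hL x v
  have e3 := sfbp_descent hf hL x ((1/2 : ℝ) • v)
  have e4 := sfbp_descent hf hL u (-(1/2 : ℝ) • v)
  have e5 := sfbp_grad_ineq hc hf x (u + -(1/2 : ℝ) • v)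
  have e6 := h0 (x + (1/2 : ℝ) • v)
  rw [hu, hgu, inner_zero_left] at e4
  rw [hu] at e1
  rw [norm_smul, mul_pow] at e3 e4
  norm_num at e3 e4
  simp only [inner_sub_right, inner_add_right, inner_smul_right, inner_neg_right, neg_smul] at *
  have k1 : f (x + v) - L / 2 * ‖v‖ ^ 2 ≤ ⟪f' x, x⟫ + ⟪f' x, v⟫ - ⟪f' x, u⟫ := by linarith
  have k2 : - (L / 4 * ‖v‖ ^ 2) ≤ ⟪f' x, x⟫ + ⟪f' x, v⟫ - ⟪f' x, u⟫ := by
    norm_num at *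
    linarith
  nlinarith [mul_le_mul_of_nonneg_left k1 hθ, mul_le_mul_of_nonneg_left k2 (sub_nonneg.2 hθ1)]

/-- consequence of the key condition -/
lemma sfbp_key (d : SFBP H) {u z : H} (hz : z ∈ nCone d.C u) :
    ∃ e : ℕ → ℝ, (∀ n, 0 ≤ e n) ∧ Summable e ∧ ∀ n (y : H) (s : ℝ), d.Ψ₂ y = (s : EReal) →
      d.lam n * ⟪z, y - u⟫ - d.lam n * d.beta n * (d.Ψ₁ y + s) ≤ e n := by
  obtain ⟨M, hM⟩ := d.keyCond z ⟨u, hz⟩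
  have huC := hz.1
  have hu' := huC
  rw [d.Cdef] at hu'
  have hu1 : d.Ψ₁ u = 0 := by
    obtain ⟨p, hp⟩ := d.minΨ₁
    exact le_antisymm (hp ▸ hu'.1 p) (d.Ψ₁nonneg u)
  have hu2 : d.Ψ₂ u = 0 := by
    obtain ⟨p, hp⟩ := d.minΨ₂
    exact le_antisymm (hp ▸ hu'.2 p) (d.Ψ₂nonneg u)
  have hsupp : ∀ n, suppFun d.C ((d.beta n)⁻¹ • z) = ((⟪(d.beta n)⁻¹ • z, u⟫ : ℝ) : EReal) := by
    intro n
    refine le_antisymm (iSup_le fun c => ?_) (le_iSup_of_le (⟨u, huC⟩ : d.C) le_rfl)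
    rw [EReal.coe_le_coe_iff, inner_smul_left, inner_smul_left]
    have := hz.2 c c.2
    rw [inner_sub_right] at this
    exact mul_le_mul_of_nonneg_left (by linarith) (by simpa using (d.betaPos n).le)
  set t : ℕ → EReal := fun n => (((d.lam n * d.beta n : ℝ)) : EReal) *
        (fenchelConj (fun q => ((d.Ψ₁ q : ℝ) : EReal) + d.Ψ₂ q) ((d.beta n)⁻¹ • z)
          - suppFun d.C ((d.beta n)⁻¹ • z)) with ht
  have hlow : ∀ n (y : H) (s : ℝ), d.Ψ₂ y = (s : EReal) →
      ((d.lam n * ⟪z, y - u⟫ - d.lam n * d.beta n * (d.Ψ₁ y + s) : ℝ) : EReal) ≤ t n := by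
    intro n y s hs
    have h1 : ((⟪y, (d.beta n)⁻¹ • z⟫ - (d.Ψ₁ y + s) : ℝ) : EReal) ≤
        fenchelConj (fun q => ((d.Ψ₁ q : ℝ) : EReal) + d.Ψ₂ q) ((d.beta n)⁻¹ • z) := by
      refine le_iSup_of_le y ?_
      simp [hs]
    have hb := d.betaPos n
    have h2 : (d.lam n * ⟪z, y - u⟫ - d.lam n * d.beta n * (d.Ψ₁ y + s) : ℝ) =
        (d.lam n * d.beta n) * (⟪y, (d.beta n)⁻¹ • z⟫ - (d.Ψ₁ y + s) - ⟪(d.beta n)⁻¹ • z, u⟫) := by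
      rw [inner_smul_left, inner_smul_right, inner_sub_right, real_inner_comm z y]
      simp only [conj_trivial]
      field_simp
      ring
    rw [h2, EReal.coe_mul, EReal.coe_sub]
    simp only [ht]
    rw [hsupp n]
    refine mul_le_mul_of_nonneg_left (EReal.sub_le_sub h1 le_rfl) ?_
    exact_mod_cast (mul_pos (d.lamPos n) hb).le
  have ht0 : ∀ n, 0 ≤ t n := by
    intro n
    have := hlow n u 0 (by simpa using hu2)
    simpa [hu1] using this
  have htM : ∀ n, t n ≤ M := fun n =>
    (Finset.single_le_sum (fun k _ => ht0 k) (Finset.self_mem_range_succ n)).trans (hM (n + 1))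
  have hcoe : ∀ n, (((t n).toReal : ℝ) : EReal) = t n := fun n =>
    EReal.coe_toReal (ne_top_of_le_ne_top (EReal.coe_ne_top M) (htM n))
      (ne_bot_of_le_ne_bot EReal.zero_ne_bot (ht0 n))
  have hn : ∀ n, 0 ≤ (t n).toReal := fun n => EReal.toReal_nonneg (ht0 n)
  refine ⟨fun n => (t n).toReal, hn, ?_, ?_⟩
  · refine summable_of_sum_range_le (c := M) hn fun N => ?_
    rw [← EReal.coe_le_coe_iff]
    have hs : ((∑ i ∈ Finset.range N, (t i).toReal : ℝ) : EReal) =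
        ∑ i ∈ Finset.range N, t i := by
      induction N with
      | zero => simp
      | succ N ih => rw [Finset.sum_range_succ, Finset.sum_range_succ, EReal.coe_add, ih, hcoe]
    rw [hs]
    exact hM N
  · intro n y s hs
    rw [← EReal.coe_le_coe_iff, hcoe]
    exact hlow n y s hs

lemma sfbp_conv (d : SFBP H) (α : ℝ) (hα : 0 < α)
    (hsc : ∀ p q, α * ‖p - q‖ ^ 2 ≤ ⟪d.Φ' p - d.Φ' q, p - q⟫) {u : H} (hu : u ∈ d.S) :
    Tendsto d.x atTop (𝓝 u) := by
  obtain ⟨za, hza, v, hv, hzv⟩ := hu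
  have hu' := hv.1
  rw [d.Cdef] at hu'
  have hu1 : d.Ψ₁ u = 0 := by
    obtain ⟨p, hp⟩ := d.minΨ₁
    exact le_antisymm (hp ▸ hu'.1 p) (d.Ψ₁nonneg u)
  have hu2 : d.Ψ₂ u = 0 := by
    obtain ⟨p, hp⟩ := d.minΨ₂
    exact le_antisymm (hp ▸ hu'.2 p) (d.Ψ₂nonneg u)
  obtain ⟨γ₀, hγ₀, hev₀⟩ := d.limsupCond
  obtain ⟨γ, hγ0, hγ2, hev⟩ : ∃ γ : ℝ, 0 ≤ γ ∧ γ < 2 ∧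
      ∀ᶠ n in atTop, d.LΨ₁ * (d.lam n * d.beta n) ≤ γ :=
    ⟨max γ₀ 0, le_max_right _ _, max_lt hγ₀ two_pos, hev₀.mono fun n h => h.trans (le_max_left _ _)⟩
  obtain ⟨N, hN⟩ := eventually_atTop.1 hev
  set θ := (2 - γ) / 4 with hθ
  have hθ0 : 0 < θ := by rw [hθ]; linarith
  have hθ1 : θ ≤ 1 := by rw [hθ]; linarith
  have hzN : θ⁻¹ • v ∈ nCone d.C u := by
    refine ⟨hv.1, fun c hc => ?_⟩
    rw [inner_smul_left]
    exact mul_nonpos_of_nonneg_of_nonpos (by simpa using hθ0.le) (hv.2 c hc)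
  obtain ⟨e, he0, hes, he⟩ := sfbp_key d hzN
  have main : ∀ n, N ≤ n → ‖d.x (n + 1) - u‖ ^ 2 ≤ ‖d.x n - u‖ ^ 2
      - (2 * α) * d.lam n * ‖d.x n - u‖ ^ 2
      + (d.LΦ / θ * (d.LΦ * d.lam n ^ 2)) * ‖d.x n - u‖ ^ 2 + 2 * θ * e n := by
    intro n hn
    obtain ⟨a, ha, w, hw, hx⟩ := d.algo n
    have hl := d.lamPos n
    have hb := d.betaPos n
    have hμ := mul_pos hl hb
    set x := d.x n
    set y := d.x (n + 1)
    have hwu := hw u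
    rw [hu2] at hwu
    obtain ⟨s, hs⟩ : ∃ s : ℝ, d.Ψ₂ y = (s : EReal) := by
      have h1 : d.Ψ₂ y ≠ ⊤ := by
        intro h
        rw [h, EReal.top_add_coe] at hwu
        simp at hwu
      exact ⟨_, (EReal.coe_toReal h1 (d.properΨ₂.2.1 y)).symm⟩
    have hs0 : 0 ≤ s := by
      have := d.Ψ₂nonneg y
      rw [hs] at this
      exact_mod_cast this
    have i1 : s ≤ ⟪w, y - u⟫ := by
      rw [hs] at hwu
      have h2 : s + ⟪w, u - y⟫ ≤ 0 := by exact_mod_cast hwu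
      rw [← neg_sub y u, inner_neg_right] at h2
      linarith
    have i2 : 0 ≤ ⟪a - za, y - u⟫ := d.maxmonA.1 y u a za ha hza
    have i3 := sfbp_pen d.convΨ₁ d.gradΨ₁ d.lipΨ₁ d.Ψ₁nonneg hu1 x (y - x) hθ0.le hθ1
    rw [add_sub_cancel] at i3
    have i4 := he n y s hs
    rw [inner_smul_left] at i4
    simp only [conj_trivial] at i4
    have i5 := hsc x u
    have i6 : -(d.LΦ * ‖x - u‖ * ‖y - x‖) ≤ ⟪d.Φ' x - d.Φ' u, y - x⟫ := by
      have h1 := (abs_le.1 (abs_real_inner_le_norm (d.Φ' x - d.Φ' u) (y - x))).1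
      have h2 := mul_le_mul_of_nonneg_right (d.lipΦ x u) (norm_nonneg (y - x))
      linarith
    have i7 := hN n hn
    have hza' : za = -(d.Φ' u) - v := by
      have := hzv
      rw [eq_sub_iff_add_eq, eq_neg_iff_add_eq_zero]
      rw [← hzv]; abel
    -- identity
    have j1 : ‖x - u‖ ^ 2 = ‖y - u‖ ^ 2 + ‖y - x‖ ^ 2 + 2 * ⟪x - y, y - u⟫ := by
      have : x - u = (x - y) + (y - u) := by abel
      rw [this, norm_add_sq_real, norm_sub_rev x y]
      ring
    have j2 : ⟪x - y, y - u⟫ = d.lam n * (⟪d.Φ' x - d.Φ' u, x - u⟫ + ⟪d.Φ' x - d.Φ' u, y - x⟫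
        + ⟪a - za, y - u⟫ - ⟪v, y - u⟫) + d.lam n * d.beta n * ⟪d.Ψ₁' x, y - u⟫
        + d.lam n * d.beta n * ⟪w, y - u⟫ := by
      rw [hx, hza', ← inner_add_right, show x - u + (y - x) = y - u by abel]
      simp only [inner_add_left, inner_sub_left, inner_smul_left, inner_neg_left, conj_trivial]
      ring
    have k1 := mul_le_mul_of_nonneg_left i1 hμ.le
    have k2 := mul_nonneg hl.le i2
    have k3 := mul_le_mul_of_nonneg_left i3 hμ.le
    have k4 : 2 * d.lam n * ⟪v, y - u⟫ - 2 * θ * (d.lam n * d.beta n) * (d.Ψ₁ y + s)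
        ≤ 2 * θ * e n := by
      have h1 := mul_le_mul_of_nonneg_left i4 (by positivity : 0 ≤ 2 * θ)
      refine le_trans (le_of_eq ?_) h1
      field_simp
    have k5 := mul_le_mul_of_nonneg_left i5 hl.le
    have k6 := mul_le_mul_of_nonneg_left i6 hl.le
    have k7 : (1 + θ) * (d.LΨ₁ * (d.lam n * d.beta n)) / 2 * ‖y - x‖ ^ 2 ≤
        (1 - θ) * ‖y - x‖ ^ 2 := by
      refine mul_le_mul_of_nonneg_right ?_ (sq_nonneg _)
      have h1 := mul_le_mul_of_nonneg_left i7 (by positivity : 0 ≤ 1 + θ)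
      have h2 : γ = 2 - 4 * θ := by rw [hθ]; ring
      rw [h2] at h1
      nlinarith
    have k8 : 2 * d.lam n * (d.LΦ * ‖x - u‖ * ‖y - x‖) ≤
        θ * ‖y - x‖ ^ 2 + (d.LΦ / θ * (d.LΦ * d.lam n ^ 2)) * ‖x - u‖ ^ 2 := by
      have h1 : 0 ≤ θ * (‖y - x‖ - d.LΦ * d.lam n * ‖x - u‖ / θ) ^ 2 := by positivity
      have h2 : θ * (‖y - x‖ - d.LΦ * d.lam n * ‖x - u‖ / θ) ^ 2 =
        θ * ‖y - x‖ ^ 2 + (d.LΦ / θ * (d.LΦ * d.lam n ^ 2)) * ‖x - u‖ ^ 2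
         - 2 * d.lam n * (d.LΦ * ‖x - u‖ * ‖y - x‖) := by
        field_simp
        ring
      linarith
    have k9 : θ * (d.lam n * d.beta n * s) ≤ d.lam n * d.beta n * s :=
      mul_le_of_le_one_left (mul_nonneg hμ.le hs0) hθ1
    rw [j2] at j1
    linarith
  have hδ : ∀ n, 0 ≤ d.LΦ / θ * (d.LΦ * d.lam n ^ 2) := fun n => by
    have : d.LΦ / θ * (d.LΦ * d.lam n ^ 2) = (d.LΦ * d.lam n) ^ 2 / θ := by ring
    rw [this]; positivity
  have hlim : Tendsto (fun n => ‖d.x (n + N) - u‖ ^ 2) atTop (𝓝 0) := by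
    refine sfbp_seq (l := fun n => d.lam (n + N)) (c := 2 * α)
      (δ := fun n => d.LΦ / θ * (d.LΦ * d.lam (n + N) ^ 2)) (e := fun n => 2 * θ * e (n + N))
      (by positivity) (fun n => sq_nonneg _) (fun n => (d.lamPos _).le) (fun n => hδ _)
      (fun n => mul_nonneg (by positivity) (he0 _)) ?_ ?_ ?_ ?_
    · exact (summable_nat_add_iff N).2 (d.sumSq.mul_left (d.LΦ / θ))
    · exact (summable_nat_add_iff N).2 (hes.mul_left (2 * θ))
    · intro h
      have h1 := (summable_nat_add_iff N).1 h
      exact not_tendsto_nhds_of_tendsto_atTop d.lamDiv _ h1.hasSum.tendsto_sum_nat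
    · intro n
      have := main (n + N) (by omega)
      rw [show n + 1 + N = n + N + 1 by ring]
      exact this
  rw [tendsto_iff_norm_sub_tendsto_zero]
  rw [← tendsto_add_atTop_iff_nat N]
  have := hlim.sqrt
  simpa using this

/-- **Theorem 2.2, strongly convex case.** Under (H₀), if `Φ` is strongly convex
with parameter `α > 0`, then `S` is a singleton `{u}` and the sequence `(x_n)`
converges strongly to `u`. -/
theorem sfbp_strong_of_stronglyConvex (d : SFBP H) (α : ℝ) (hα : 0 < α)
    (hsc : ∀ p q, α * ‖p - q‖ ^ 2 ≤ ⟪d.Φ' p - d.Φ' q, p - q⟫) :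
    ∃ u, d.S = {u} ∧ Filter.Tendsto d.x Filter.atTop (𝓝 u) := by
  obtain ⟨u, hu⟩ := d.Sne
  have hu' : u ∈ d.S := hu
  have hc := sfbp_conv d α hα hsc hu'
  refine ⟨u, Set.eq_singleton_iff_unique_mem.2 ⟨hu', fun p hp => ?_⟩, hc⟩
  exact tendsto_nhds_unique (sfbp_conv d α hα hsc hp) hc
end

section
/- (Theorem 2.3, case (i)) Assume hypotheses (H₀) with A = ∂Φ₂. If liminf_n λ_n β_n > 0 and at least one of the functions Φ + Φ₂ or Ψ₁ + Ψ₂ is boundedly inf-compact, then the sequence (x_n) converges weakly to a point of S as n → ∞; moreover, if Ψ₁ + Ψ₂ is boundedly inf-compact, then (x_n) converges strongly (in norm) to that point. -/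
open Filter Topology
open scoped RealInnerProductSpace

variable {H : Type*} [NormedAddCommGroup H] [InnerProductSpace ℝ H] [CompleteSpace H]

section helpers


theorem grad_line {f : H → ℝ} {g : H → H} (hg : ∀ p, HasGradientAt f (g p) p) (x v : H) (t : ℝ) :
    HasDerivAt (fun s : ℝ => f (x + s • v)) ⟪g (x + t • v), v⟫ t := by
  have h1 : HasDerivAt (fun s : ℝ => x + s • v) v t := by
    simpa using ((hasDerivAt_id t).smul_const v).const_add x
  have h2 := (hg (x + t • v)).hasFDerivAt.comp_hasDerivAt t h1
  rw [InnerProductSpace.toDual_apply_apply] at h2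
  exact h2

theorem grad_convex {f : H → ℝ} {g : H → H} (hg : ∀ p, HasGradientAt f (g p) p)
    (hc : ConvexOn ℝ Set.univ f) (x y : H) : f x + ⟪g x, y - x⟫ ≤ f y := by
  have hd := grad_line hg x (y - x) 0
  have hcv : ConvexOn ℝ Set.univ (fun s : ℝ => f (x + s • (y - x))) := by
    refine ⟨convex_univ, fun a _ b _ s t hs ht hst => ?_⟩
    have := hc.2 (Set.mem_univ (x + a • (y - x))) (Set.mem_univ (x + b • (y - x))) hs ht hst
    have e : s • (x + a • (y - x)) + t • (x + b • (y - x)) = x + (s • a + t • b) • (y - x) := by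
      have ht' : t = 1 - s := by linarith
      subst ht'
      simp only [smul_eq_mul]
      module
    rw [e] at this
    exact this
  have := hcv.le_slope_of_hasDerivAt (Set.mem_univ 0) (Set.mem_univ 1) one_pos hd
  simp [slope_def_field] at this
  simpa using by linarith

theorem grad_descent {f : H → ℝ} {g : H → H} (hg : ∀ p, HasGradientAt f (g p) p) {L : ℝ}
    (hL : ∀ p q, ‖g p - g q‖ ≤ L * ‖p - q‖) (x v : H) :
    f (x + v) ≤ f x + ⟪g x, v⟫ + L / 2 * ‖v‖ ^ 2 := by
  have hd : ∀ t : ℝ, HasDerivAt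
      (fun s : ℝ => f (x + s • v) - s * ⟪g x, v⟫ - s ^ 2 * (L / 2 * ‖v‖ ^ 2))
      (⟪g (x + t • v), v⟫ - ⟪g x, v⟫ - (2 * t) * (L / 2 * ‖v‖ ^ 2)) t := by
    intro t
    have h2 : HasDerivAt (fun s : ℝ => s * ⟪g x, v⟫) ⟪g x, v⟫ t := by
      simpa using (hasDerivAt_id t).mul_const ⟪g x, v⟫
    have h3 : HasDerivAt (fun s : ℝ => s ^ 2 * (L / 2 * ‖v‖ ^ 2)) ((2 * t) * (L / 2 * ‖v‖ ^ 2)) t := by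
      simpa using (hasDerivAt_pow 2 t).mul_const (L / 2 * ‖v‖ ^ 2)
    exact ((grad_line hg x v t).sub h2).sub h3
  have hanti : AntitoneOn
      (fun s : ℝ => f (x + s • v) - s * ⟪g x, v⟫ - s ^ 2 * (L / 2 * ‖v‖ ^ 2)) (Set.Icc 0 1) := by
    apply antitoneOn_of_deriv_nonpos (convex_Icc 0 1)
    · exact fun t _ => (hd t).continuousAt.continuousWithinAt
    · exact fun t _ => (hd t).differentiableAt.differentiableWithinAt
    · intro t ht
      rw [interior_Icc] at ht
      rw [(hd t).deriv, ← inner_sub_left]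
      have h1 := real_inner_le_norm (g (x + t • v) - g x) v
      have h2 := hL (x + t • v) x
      rw [add_sub_cancel_left, norm_smul, Real.norm_eq_abs, abs_of_pos ht.1] at h2
      have h3 := mul_le_mul_of_nonneg_right h2 (norm_nonneg v)
      nlinarith
  have := hanti (Set.left_mem_Icc.2 zero_le_one) (Set.right_mem_Icc.2 zero_le_one) zero_le_one
  simp at this
  linarith

/-- Combined penalisation estimate. -/
theorem pen_est {f : H → ℝ} {g : H → H} (hg : ∀ p, HasGradientAt f (g p) p) {L : ℝ}
    (hL : ∀ p q, ‖g p - g q‖ ≤ L * ‖p - q‖) (hc : ConvexOn ℝ Set.univ f)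
    (hf : ∀ p, 0 ≤ f p) {u : H} (hu : f u = 0) (x y : H) {η : ℝ} (h0 : 0 ≤ η) (h1 : η ≤ 1) :
    η * f y - L * (1 + η) / 4 * ‖y - x‖ ^ 2 ≤ ⟪g x, y - u⟫ := by
  have hgu : g u = 0 := by
    have hmin : IsLocalMin f u := Filter.Eventually.of_forall fun p => by rw [hu]; exact hf p
    have := hmin.hasFDerivAt_eq_zero (hg u).hasFDerivAt
    simpa using this
  have a1 := grad_descent hg hL x (y - x)
  have a2 := grad_convex hg hc x u
  set w : H := (2⁻¹ : ℝ) • (y - x) with hw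
  have b1 := grad_convex hg hc x (u - w)
  have b2 := grad_descent hg hL u (-w)
  have b3 := grad_descent hg hL x w
  have b4 := hf (x + w)
  have nw : ‖w‖ ^ 2 = ‖y - x‖ ^ 2 / 4 := by
    rw [hw, norm_smul, mul_pow]; norm_num; ring
  have iw : ⟪g x, w⟫ = ⟪g x, y - x⟫ / 2 := by
    rw [hw, real_inner_smul_right]; ring
  rw [hgu, hu, inner_zero_left, norm_neg, nw, ← sub_eq_add_neg] at b2
  rw [nw, iw] at b3
  have e1 : ⟪g x, u - w - x⟫ = ⟪g x, u - x⟫ - ⟪g x, y - x⟫ / 2 := by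
    rw [← iw, ← inner_sub_right]; congr 1; abel
  rw [e1] at b1
  have e2 : ⟪g x, y - u⟫ = ⟪g x, y - x⟫ - ⟪g x, u - x⟫ := by
    rw [← inner_sub_right]; congr 1; abel
  rw [add_sub_cancel] at a1
  rw [hu] at a2
  rw [e2]
  have c1 : f y - L / 2 * ‖y - x‖ ^ 2 ≤ ⟪g x, y - x⟫ - ⟪g x, u - x⟫ := by linarith
  have c2 : - (L / 4 * ‖y - x‖ ^ 2) ≤ ⟪g x, y - x⟫ - ⟪g x, u - x⟫ := by nlinarith
  have d1 := mul_le_mul_of_nonneg_left c1 h0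
  have d2 := mul_le_mul_of_nonneg_left c2 (sub_nonneg.2 h1)
  nlinarith

theorem quasi_fejer {a b e : ℕ → ℝ} (ha : ∀ n, 0 ≤ a n) (hb : ∀ n, 0 ≤ b n) (he : ∀ n, 0 ≤ e n)
    (hs : Summable e) (h : ∀ᶠ n in atTop, a (n + 1) + b n ≤ a n + e n) :
    (∃ l, Tendsto a atTop (𝓝 l)) ∧ Summable b := by
  obtain ⟨N, hN⟩ := eventually_atTop.1 h
  have hsum : Summable (fun k => e (k + N)) := (summable_nat_add_iff N).2 hs
  set E : ℝ := ∑' k, e (k + N) with hE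
  have hle : ∀ n, ∑ k ∈ Finset.range n, e (k + N) ≤ E := fun n =>
    hsum.sum_le_tsum _ fun _ _ => he _
  have hanti : Antitone (fun n => a (n + N) - ∑ k ∈ Finset.range n, e (k + N)) := by
    apply antitone_nat_of_succ_le
    intro n
    rw [Finset.sum_range_succ]
    have := hN (n + N) (by omega)
    have e1 : n + 1 + N = n + N + 1 := by omega
    rw [e1]
    have := hb (n + N)
    linarith
  have hbd : BddBelow (Set.range (fun n => a (n + N) - ∑ k ∈ Finset.range n, e (k + N))) := by
    refine ⟨-E, ?_⟩
    rintro _ ⟨n, rfl⟩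
    have := hle n
    have := ha (n + N)
    simp only
    linarith
  constructor
  · have t1 := tendsto_atTop_ciInf hanti hbd
    have t2 := hsum.hasSum.tendsto_sum_nat
    have t3 := t1.add t2
    simp only [sub_add_cancel] at t3
    exact ⟨_, (tendsto_add_atTop_iff_nat N).1 t3⟩
  · refine (summable_nat_add_iff N).1 (summable_of_sum_range_le (c := a N + E) (fun _ => hb _) ?_)
    intro n
    have key : ∀ n, a (n + N) + ∑ k ∈ Finset.range n, b (k + N) ≤
        a N + ∑ k ∈ Finset.range n, e (k + N) := by
      intro n
      induction n with
      | zero => simp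
      | succ n ih =>
        rw [Finset.sum_range_succ, Finset.sum_range_succ]
        have := hN (n + N) (by omega)
        have e1 : n + 1 + N = n + N + 1 := by omega
        rw [e1]
        linarith
    have := key n
    have := hle n
    have := ha (n + N)
    linarith

theorem ereal_coe_sum (f : ℕ → ℝ) (s : Finset ℕ) :
    ((∑ i ∈ s, f i : ℝ) : EReal) = ∑ i ∈ s, ((f i : ℝ) : EReal) := by
  classical
  induction s using Finset.induction_on with
  | empty => simp
  | insert a s ha ih => rw [Finset.sum_insert ha, Finset.sum_insert ha, EReal.coe_add, ih]

theorem lsc_le {F : H → EReal} (hF : LowerSemicontinuous F) {y : ℕ → H} {p : H}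
    (hy : Tendsto y atTop (𝓝 p)) {r : ℕ → ℝ} {s : ℝ} (hr : Tendsto r atTop (𝓝 s))
    (h : ∀ k, F (y k) ≤ (r k : EReal)) : F p ≤ (s : EReal) := by
  by_contra hcon
  rw [not_le] at hcon
  obtain ⟨q, hq1, hq2⟩ := EReal.lt_iff_exists_real_btwn.1 hcon
  have h1 := hy.eventually (hF p _ hq2)
  have h2 := hr.eventually (gt_mem_nhds (EReal.coe_lt_coe_iff.1 hq1))
  obtain ⟨k, hk1, hk2⟩ := (h1.and h2).exists
  have := hk1.trans_le (h k)
  exact absurd (EReal.coe_lt_coe_iff.1 this) (not_lt.2 hk2.le)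

/-- Subgradients live over the domain. -/
theorem subdiff_ne_top {F : H → EReal} (hF : ProperLscConvexE F) {x p : H} (h : p ∈ ESubdiff F x) :
    F x ≠ ⊤ := by
  intro hx
  obtain ⟨y, hy⟩ := hF.1
  have := h y
  rw [hx, EReal.top_add_coe, top_le_iff] at this
  exact hy this

theorem subdiff_real {F : H → EReal} (hF : ProperLscConvexE F) {x p : H} (h : p ∈ ESubdiff F x)
    {y : H} (hy : F y ≠ ⊤) : (F x).toReal + ⟪p, y - x⟫ ≤ (F y).toReal := by
  have := h y
  rw [← EReal.coe_toReal (subdiff_ne_top hF h) (hF.2.1 x), ← EReal.coe_toReal hy (hF.2.1 y),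
    ← EReal.coe_add, EReal.coe_le_coe_iff] at this
  exact this

theorem mem_C (d : SFBP H) {u : H} : u ∈ d.C ↔ d.Ψ₁ u = 0 ∧ d.Ψ₂ u = 0 := by
  rw [d.Cdef]
  constructor
  · rintro ⟨h1, h2⟩
    obtain ⟨p, hp⟩ := d.minΨ₁
    obtain ⟨q, hq⟩ := d.minΨ₂
    exact ⟨le_antisymm (hp ▸ h1 p) (d.Ψ₁nonneg u), le_antisymm (hq ▸ h2 q) (d.Ψ₂nonneg u)⟩
  · rintro ⟨h1, h2⟩
    refine ⟨fun q => ?_, fun q => ?_⟩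
    · rw [h1]; exact d.Ψ₁nonneg q
    · rw [h2]; exact d.Ψ₂nonneg q

theorem algo_fin (d : SFBP H) (n : ℕ) : d.Ψ₂ (d.x (n + 1)) ≠ ⊤ := by
  obtain ⟨a, -, w, hw, -⟩ := d.algo n
  exact subdiff_ne_top d.properΨ₂ hw

theorem algo_fin₂ (d : SFBP H) {Φ₂ : H → EReal}
    (hΦ₂ : ProperLscConvexE Φ₂) (hA : d.A = ESubdiff Φ₂) (n : ℕ) : Φ₂ (d.x (n + 1)) ≠ ⊤ := by
  obtain ⟨a, ha, -⟩ := d.algo n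
  exact subdiff_ne_top hΦ₂ (hA ▸ ha)

theorem main_est (d : SFBP H) {Φ₂ : H → EReal}
    (hΦ₂ : ProperLscConvexE Φ₂) (hA : d.A = ESubdiff Φ₂) :
    ∃ η : ℝ, 0 < η ∧ ∀ᶠ n in atTop, ∀ u ∈ d.C, Φ₂ u ≠ ⊤ →
      ‖d.x (n + 1) - u‖ ^ 2 +
        2 * η * (d.lam n * d.beta n * (d.Ψ₁ (d.x (n + 1)) + (d.Ψ₂ (d.x (n + 1))).toReal)) +
        2 * d.lam n * ((d.Φ (d.x (n + 1)) + (Φ₂ (d.x (n + 1))).toReal) - (d.Φ u + (Φ₂ u).toReal))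
        ≤ ‖d.x n - u‖ ^ 2 := by
  obtain ⟨γ₀, hγ₀, hev⟩ := d.limsupCond
  set γ := max γ₀ 0 with hγ
  have hγ0 : 0 ≤ γ := le_max_right _ _
  have hγ2 : γ < 2 := max_lt hγ₀ two_pos
  refine ⟨(2 - γ) / 4, by linarith, ?_⟩
  set η := (2 - γ) / 4 with hη
  have hη0 : 0 < η := by rw [hη]; linarith
  have hη1 : η ≤ 1 / 2 := by rw [hη]; linarith
  have hlim : Tendsto (fun n => d.LΦ * d.lam n) atTop (𝓝 0) := by
    have h1 := d.sumSq.tendsto_atTop_zero.const_mul d.LΦ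
    rw [mul_zero] at h1
    have h2 : Tendsto (fun n => |d.LΦ * d.lam n|) atTop (𝓝 0) := by
      have h3 := h1.sqrt
      rw [Real.sqrt_zero] at h3
      refine h3.congr fun n => ?_
      rw [← Real.sqrt_sq_eq_abs]
      congr 1; ring
    exact (tendsto_zero_iff_abs_tendsto_zero _).2 h2
  filter_upwards [hev, hlim.eventually (gt_mem_nhds hη0)] with n hn1 hn2 u hu hu2
  obtain ⟨hu1, hu2'⟩ := (mem_C d).1 hu
  obtain ⟨a, ha, w, hw, hrec⟩ := d.algo n
  rw [hA] at ha
  have hl := d.lamPos n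
  have hb := d.betaPos n
  set x := d.x n
  set y := d.x (n + 1)
  set l := d.lam n
  set b := d.beta n
  have s1 := subdiff_real hΦ₂ ha hu2
  have s2 := subdiff_real d.properΨ₂ hw (y := u) (by rw [hu2']; exact EReal.zero_ne_top)
  rw [hu2', EReal.toReal_zero] at s2
  have s3 := pen_est d.gradΨ₁ d.lipΨ₁ d.convΨ₁ d.Ψ₁nonneg hu1 x y hη0.le (by linarith)
  have s4 := grad_descent d.gradΦ d.lipΦ x (y - x)
  have s5 := grad_convex d.gradΦ d.convΦ x u
  rw [add_sub_cancel] at s4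
  have hψ2 : 0 ≤ (d.Ψ₂ y).toReal := EReal.toReal_nonneg (d.Ψ₂nonneg y)
  have neg : ∀ p : H, ⟪p, u - y⟫ = - ⟪p, y - u⟫ := fun p => by
    rw [← inner_neg_right, neg_sub]
  rw [neg] at s1 s2
  have e2 : ⟪d.Φ' x, y - u⟫ = ⟪d.Φ' x, y - x⟫ - ⟪d.Φ' x, u - x⟫ := by
    rw [← inner_sub_right]; congr 1; abel
  have id1 : ‖x - u‖ ^ 2 = ‖y - x‖ ^ 2 + 2 * ⟪x - y, y - u⟫ + ‖y - u‖ ^ 2 := by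
    have : x - u = (x - y) + (y - u) := by abel
    rw [this, norm_add_sq_real, norm_sub_rev x y]
  have id2 : ⟪x - y, y - u⟫ = l * (⟪d.Φ' x, y - u⟫ + b * ⟪d.Ψ₁' x, y - u⟫ + ⟪a, y - u⟫
      + b * ⟪w, y - u⟫) := by
    rw [hrec, real_inner_smul_left, inner_add_left, inner_add_left, inner_add_left,
      real_inner_smul_left, real_inner_smul_left]
  rw [id1, id2]
  set D := ‖y - x‖ ^ 2 with hD
  have hD0 : 0 ≤ D := sq_nonneg _
  have k1 : d.Φ y - d.Φ u - d.LΦ / 2 * D ≤ ⟪d.Φ' x, y - u⟫ := by rw [e2]; linarith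
  have k2 : (Φ₂ y).toReal - (Φ₂ u).toReal ≤ ⟪a, y - u⟫ := by linarith
  have k3 : η * (d.Ψ₂ y).toReal ≤ ⟪w, y - u⟫ := by nlinarith
  have m1 := mul_le_mul_of_nonneg_left k1 hl.le
  have m2 := mul_le_mul_of_nonneg_left k2 hl.le
  have m3 := mul_le_mul_of_nonneg_left k3 (mul_pos hl hb).le
  have m4 := mul_le_mul_of_nonneg_left s3 (mul_pos hl hb).le
  have q1 : d.LΨ₁ * (l * b) * ((1 + η) / 2) * D ≤ (1 - η) * D := by
    apply mul_le_mul_of_nonneg_right _ hD0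
    have : d.LΨ₁ * (l * b) ≤ γ := hn1.trans (le_max_left _ _)
    have : d.LΨ₁ * (l * b) * ((1 + η) / 2) ≤ γ * ((1 + η) / 2) :=
      mul_le_mul_of_nonneg_right this (by linarith)
    have : γ * η ≤ 2 * η := mul_le_mul_of_nonneg_right hγ2.le hη0.le
    rw [hη] at *
    linarith
  have q2 : d.LΦ * l * D ≤ η * D := mul_le_mul_of_nonneg_right hn2.le hD0
  nlinarith

theorem key_sum (d : SFBP H) {z u : H} (hz : z ∈ nCone d.C u) :
    Summable fun n => max 0 (d.lam n * ⟪z, d.x (n + 1) - u⟫ - d.lam n * d.beta n *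
      (d.Ψ₁ (d.x (n + 1)) + (d.Ψ₂ (d.x (n + 1))).toReal)) := by
  obtain ⟨M, hM⟩ := d.keyCond z ⟨u, hz⟩
  refine summable_of_sum_range_le (c := M) (fun _ => le_max_left _ _) fun N => ?_
  rw [← EReal.coe_le_coe_iff]
  refine le_trans ?_ (hM N)
  rw [ereal_coe_sum]
  refine Finset.sum_le_sum fun n _ => ?_
  have hl := d.lamPos n
  have hb := d.betaPos n
  obtain ⟨hu1, hu2⟩ := (mem_C d).1 hz.1
  have hsupp : suppFun d.C ((d.beta n)⁻¹ • z) = ((⟪(d.beta n)⁻¹ • z, u⟫ : ℝ) : EReal) := by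
    apply le_antisymm
    · refine iSup_le fun c => ?_
      rw [EReal.coe_le_coe_iff, real_inner_smul_left, real_inner_smul_left]
      have := hz.2 c c.2
      rw [inner_sub_right] at this
      exact mul_le_mul_of_nonneg_left (by linarith) (inv_pos.2 hb).le
    · exact le_iSup (fun c : d.C => ((⟪(d.beta n)⁻¹ • z, (c : H)⟫ : ℝ) : EReal)) ⟨u, hz.1⟩
  have hconj : ∀ y, d.Ψ₂ y ≠ ⊤ → ((⟪y, (d.beta n)⁻¹ • z⟫ - (d.Ψ₁ y + (d.Ψ₂ y).toReal) : ℝ) : EReal) ≤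
      fenchelConj (fun q => ((d.Ψ₁ q : ℝ) : EReal) + d.Ψ₂ q) ((d.beta n)⁻¹ • z) := by
    intro y hy
    refine le_trans (le_of_eq ?_) (le_iSup _ y)
    rw [EReal.coe_sub, EReal.coe_add, EReal.coe_toReal hy (d.properΨ₂.2.1 y)]
  have hgen : ∀ y, d.Ψ₂ y ≠ ⊤ → ((d.lam n * ⟪z, y - u⟫ - d.lam n * d.beta n *
      (d.Ψ₁ y + (d.Ψ₂ y).toReal) : ℝ) : EReal) ≤ (((d.lam n * d.beta n : ℝ)) : EReal) *
        (fenchelConj (fun q => ((d.Ψ₁ q : ℝ) : EReal) + d.Ψ₂ q) ((d.beta n)⁻¹ • z)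
          - suppFun d.C ((d.beta n)⁻¹ • z)) := by
    intro y hy
    have h1 := EReal.sub_le_sub (hconj y hy) (le_refl (suppFun d.C ((d.beta n)⁻¹ • z)))
    refine le_trans (le_of_eq ?_) (mul_le_mul_of_nonneg_left h1
      (EReal.coe_nonneg.2 (mul_pos hl hb).le))
    rw [hsupp, ← EReal.coe_sub, ← EReal.coe_mul, EReal.coe_eq_coe_iff]
    rw [real_inner_smul_right, real_inner_smul_left, inner_sub_right, real_inner_comm z y]
    field_simp
    ring
  rcases max_cases 0 (d.lam n * ⟪z, d.x (n + 1) - u⟫ - d.lam n * d.beta n *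
      (d.Ψ₁ (d.x (n + 1)) + (d.Ψ₂ (d.x (n + 1))).toReal)) with h | h
  · rw [h.1]
    have := hgen u (by rw [hu2]; exact EReal.zero_ne_top)
    simpa [hu1, hu2] using this
  · rw [h.1]
    exact hgen _ (algo_fin d n)

/-- Points of `S` : Fejér-type consequences. -/
theorem fejer_S (d : SFBP H) {Φ₂ : H → EReal}
    (hΦ₂ : ProperLscConvexE Φ₂) (hA : d.A = ESubdiff Φ₂) {u : H} (hu : u ∈ d.S) :
    (∃ l, Tendsto (fun n => ‖d.x n - u‖ ^ 2) atTop (𝓝 l)) ∧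
    Summable fun n => d.lam n * d.beta n * (d.Ψ₁ (d.x (n + 1)) + (d.Ψ₂ (d.x (n + 1))).toReal) := by
  obtain ⟨η, hη, hest⟩ := main_est d hΦ₂ hA
  obtain ⟨za, hza, v, hv, h0⟩ := hu
  rw [hA] at hza
  have hz : (2 / η) • v ∈ nCone d.C u := by
    refine ⟨hv.1, fun c hc => ?_⟩
    rw [real_inner_smul_left]
    exact mul_nonpos_of_nonneg_of_nonpos (by positivity) (hv.2 c hc)
  have hs := (key_sum d hz).mul_left η
  have hψ : ∀ n, 0 ≤ d.lam n * d.beta n * (d.Ψ₁ (d.x (n + 1)) + (d.Ψ₂ (d.x (n + 1))).toReal) :=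
    fun n => mul_nonneg (mul_pos (d.lamPos n) (d.betaPos n)).le
      (add_nonneg (d.Ψ₁nonneg _) (EReal.toReal_nonneg (d.Ψ₂nonneg _)))
  have := quasi_fejer (a := fun n => ‖d.x n - u‖ ^ 2)
    (b := fun n => η * (d.lam n * d.beta n * (d.Ψ₁ (d.x (n + 1)) + (d.Ψ₂ (d.x (n + 1))).toReal)))
    (fun _ => sq_nonneg _) (fun n => mul_nonneg hη.le (hψ n))
    (fun n => mul_nonneg hη.le (le_max_left _ _)) hs (by
      filter_upwards [hest] with n hn
      have h1 := hn u hv.1 (subdiff_ne_top hΦ₂ hza)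
      have h2 := subdiff_real hΦ₂ hza (algo_fin₂ d hΦ₂ hA n)
      have h3 := grad_convex d.gradΦ d.convΦ u (d.x (n + 1))
      have h4 : ⟪za, d.x (n + 1) - u⟫ + ⟪d.Φ' u, d.x (n + 1) - u⟫ + ⟪v, d.x (n + 1) - u⟫ = 0 := by
        rw [← inner_add_left, ← inner_add_left, h0, inner_zero_left]
      have h5 := le_max_right 0 (d.lam n * ⟪(2 / η) • v, d.x (n + 1) - u⟫ - d.lam n * d.beta n *
        (d.Ψ₁ (d.x (n + 1)) + (d.Ψ₂ (d.x (n + 1))).toReal))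
      have h6 := mul_le_mul_of_nonneg_left h5 hη.le
      rw [real_inner_smul_left] at h6
      have h7 : η * (d.lam n * (2 / η * ⟪v, d.x (n + 1) - u⟫)) =
        2 * d.lam n * ⟪v, d.x (n + 1) - u⟫ := by field_simp
      rw [mul_sub, h7] at h6
      rw [real_inner_smul_left]
      have h8 : - ⟪v, d.x (n + 1) - u⟫ ≤
        (d.Φ (d.x (n + 1)) + (Φ₂ (d.x (n + 1))).toReal) - (d.Φ u + (Φ₂ u).toReal) := by linarith
      have h9 := mul_le_mul_of_nonneg_left h8 (mul_pos two_pos (d.lamPos n)).le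
      linarith)
  refine ⟨this.1, ?_⟩
  have h2 := this.2.mul_left η⁻¹
  refine h2.congr fun n => ?_
  rw [← mul_assoc, inv_mul_cancel₀ hη.ne', one_mul]

theorem S_min (d : SFBP H) {Φ₂ : H → EReal}
    (hΦ₂ : ProperLscConvexE Φ₂) (hA : d.A = ESubdiff Φ₂) {u : H} (hu : u ∈ d.S) {y : H}
    (hy : y ∈ d.C) (hy2 : Φ₂ y ≠ ⊤) : d.Φ u + (Φ₂ u).toReal ≤ d.Φ y + (Φ₂ y).toReal := by
  obtain ⟨za, hza, v, hv, h0⟩ := hu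
  rw [hA] at hza
  have h2 := subdiff_real hΦ₂ hza hy2
  have h3 := grad_convex d.gradΦ d.convΦ u y
  have h4 : ⟪za, y - u⟫ + ⟪d.Φ' u, y - u⟫ + ⟪v, y - u⟫ = 0 := by
    rw [← inner_add_left, ← inner_add_left, h0, inner_zero_left]
  have := hv.2 y hy
  linarith

theorem mem_S_of_min (d : SFBP H) {Φ₂ : H → EReal}
    (hΦ₂ : ProperLscConvexE Φ₂) (hA : d.A = ESubdiff Φ₂) {p : H} (hp : p ∈ d.C)
    (hp2 : Φ₂ p ≠ ⊤)
    (hmin : ∀ y ∈ d.C, Φ₂ y ≠ ⊤ → d.Φ p + (Φ₂ p).toReal ≤ d.Φ y + (Φ₂ y).toReal) : p ∈ d.S := by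
  set T : H → Set H := fun p => {w | ∃ za ∈ d.A p, ∃ v ∈ nCone d.C p, w = za + d.Φ' p + v} with hT
  have key : ∀ y w, w ∈ T y → 0 ≤ ⟪w, y - p⟫ := by
    rintro y w ⟨za, hza, v, hv, rfl⟩
    rw [hA] at hza
    have h1 := subdiff_real hΦ₂ hza hp2
    have h2 := grad_convex d.gradΦ d.convΦ y p
    have h3 := hv.2 p hp
    have h4 := hmin y hv.1 (subdiff_ne_top hΦ₂ hza)
    have h5 : ⟪za + d.Φ' y + v, y - p⟫ = -(⟪za, p - y⟫ + ⟪d.Φ' y, p - y⟫ + ⟪v, p - y⟫) := by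
      rw [← inner_add_left, ← inner_add_left, ← inner_neg_right, neg_sub]
    rw [h5]; linarith
  have hB := d.maxmonT.2 (fun y => T y ∪ {w | y = p ∧ w = 0}) (by
    rintro x y x' y' (hx | ⟨rfl, rfl⟩) (hy | ⟨rfl, rfl⟩)
    · exact d.maxmonT.1 x y x' y' hx hy
    · simpa using key x x' hx
    · have := key y y' hy
      rw [zero_sub, inner_neg_left, ← inner_neg_right, neg_sub]
      exact this
    · simp) (fun x => Set.subset_union_left)
  have h0 : (0 : H) ∈ T p := by
    have : (0 : H) ∈ (fun y => T y ∪ {w | y = p ∧ w = 0}) p := Or.inr ⟨rfl, rfl⟩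
    rw [hB] at this
    exact this
  obtain ⟨za, hza, v, hv, h⟩ := h0
  exact ⟨za, hza, v, hv, h.symm⟩

end helpers

theorem strong_conv (d : SFBP H) (Φ₂ : H → EReal)
    (hΦ₂ : ProperLscConvexE Φ₂) (hA : d.A = ESubdiff Φ₂)
    (hlb : ∃ ε > (0:ℝ), ∀ᶠ n in Filter.atTop, ε ≤ d.lam n * d.beta n)
    (hic : BddInfCompact (fun p => ((d.Φ p : ℝ) : EReal) + Φ₂ p) ∨
           BddInfCompact (fun p => ((d.Ψ₁ p : ℝ) : EReal) + d.Ψ₂ p)) :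
    ∃ p ∈ d.S, Tendsto d.x atTop (𝓝 p) := by
  obtain ⟨u, hu⟩ : ∃ u, u ∈ d.S := d.Sne
  obtain ⟨⟨l, hl⟩, hsum⟩ := fejer_S d hΦ₂ hA hu
  have huC : u ∈ d.C := by obtain ⟨za, hza, v, hv, h0⟩ := hu; exact hv.1
  have hu2 : Φ₂ u ≠ ⊤ := by
    obtain ⟨za, hza, v, hv, h0⟩ := hu; exact subdiff_ne_top hΦ₂ (hA ▸ hza)
  set Fs := d.Φ u + (Φ₂ u).toReal with hFs
  set ψ : ℕ → ℝ := fun n => d.Ψ₁ (d.x (n + 1)) + (d.Ψ₂ (d.x (n + 1))).toReal with hψ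
  set F : ℕ → ℝ := fun n => d.Φ (d.x (n + 1)) + (Φ₂ (d.x (n + 1))).toReal with hF
  have hψ0 : ∀ n, 0 ≤ ψ n := fun n =>
    add_nonneg (d.Ψ₁nonneg _) (EReal.toReal_nonneg (d.Ψ₂nonneg _))
  have hψlim : Tendsto ψ atTop (𝓝 0) := by
    obtain ⟨ε, hε, hev⟩ := hlb
    have h1 := hsum.tendsto_atTop_zero.const_mul ε⁻¹
    rw [mul_zero] at h1
    refine squeeze_zero' (Eventually.of_forall hψ0) ?_ h1
    filter_upwards [hev] with n hn
    rw [le_inv_mul_iff₀ hε]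
    exact mul_le_mul_of_nonneg_right hn (hψ0 n)
  -- boundedness
  obtain ⟨B, hB⟩ := hl.bddAbove_range
  have hbd : ∀ n, ‖d.x n‖ ≤ (B + 1) + ‖u‖ := by
    intro n
    have h1 : ‖d.x n - u‖ ^ 2 ≤ B := hB ⟨n, rfl⟩
    have h2 : ‖d.x n - u‖ ≤ B + 1 := by nlinarith [sq_nonneg (‖d.x n - u‖ - 1)]
    have h3 : ‖d.x n‖ ≤ ‖d.x n - u‖ + ‖u‖ := by
      simpa using norm_add_le (d.x n - u) u
    linarith
  -- infinitely often near-optimal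
  have hfreq : ∀ k : ℕ, ∃ᶠ n in atTop, F n < Fs + 1 / ((k : ℝ) + 1) := by
    intro k hcon
    have hk : (0 : ℝ) < 1 / ((k : ℝ) + 1) := by positivity
    obtain ⟨η, hη, hest⟩ := main_est d hΦ₂ hA
    have h := (quasi_fejer (a := fun n => ‖d.x n - u‖ ^ 2)
      (b := fun n => 2 * (1 / ((k : ℝ) + 1)) * d.lam n) (e := fun _ => 0)
      (fun _ => sq_nonneg _) (fun n => mul_nonneg (by positivity) (d.lamPos n).le)
      (fun _ => le_rfl) summable_zero (by
        filter_upwards [hest, hcon] with n hn hn2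
        have h1 := hn u huC hu2
        have h2 : 1 / ((k : ℝ) + 1) ≤ F n - Fs := by linarith
        have h3 := mul_le_mul_of_nonneg_left h2 (mul_pos two_pos (d.lamPos n)).le
        have h4 : 0 ≤ 2 * η * (d.lam n * d.beta n * ψ n) :=
          mul_nonneg (by linarith) (mul_nonneg (mul_pos (d.lamPos n) (d.betaPos n)).le (hψ0 n))
        simp only [hF, hψ, hFs] at *
        linarith)).2
    have h5 : Summable d.lam := by
      have := h.mul_left (2 * (1 / ((k : ℝ) + 1)))⁻¹
      refine this.congr fun n => ?_
      rw [← mul_assoc, inv_mul_cancel₀ (by positivity), one_mul]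
    exact not_tendsto_nhds_of_tendsto_atTop d.lamDiv _ h5.hasSum.tendsto_sum_nat
  obtain ⟨φ, hφ, hφF⟩ := extraction_forall_of_frequently hfreq
  have hFE : ∀ n, ((d.Φ (d.x (n + 1)) : ℝ) : EReal) + Φ₂ (d.x (n + 1)) = (F n : EReal) := fun n => by
    rw [hF, EReal.coe_add, EReal.coe_toReal (algo_fin₂ d hΦ₂ hA n) (hΦ₂.2.1 _)]
  have hψE : ∀ n, ((d.Ψ₁ (d.x (n + 1)) : ℝ) : EReal) + d.Ψ₂ (d.x (n + 1)) = (ψ n : EReal) :=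
    fun n => by
      rw [hψ, EReal.coe_add, EReal.coe_toReal (algo_fin d n) (d.properΨ₂.2.1 _)]
  -- a compact set containing the subsequence
  obtain ⟨K, hK, hKmem⟩ : ∃ K : Set H, IsCompact K ∧ ∀ k, d.x (φ k + 1) ∈ K := by
    have hR : 0 ≤ (B + 1) + ‖u‖ := (norm_nonneg _).trans (hbd 0)
    rcases hic with h | h
    · refine ⟨_, h ((B + 1) + ‖u‖) (Fs + 1) hR, fun k => subset_closure ⟨hbd _, ?_⟩⟩
      show ((d.Φ (d.x (φ k + 1)) : ℝ) : EReal) + Φ₂ (d.x (φ k + 1)) ≤ _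
      rw [hFE, EReal.coe_le_coe_iff]
      have h1 := hφF k
      have h2 : 1 / ((k : ℝ) + 1) ≤ 1 := by
        rw [div_le_one (by positivity)]
        have : (0 : ℝ) ≤ k := Nat.cast_nonneg k
        linarith
      linarith
    · obtain ⟨M, hM⟩ := hψlim.bddAbove_range
      refine ⟨_, h ((B + 1) + ‖u‖) M hR, fun k => subset_closure ⟨hbd _, ?_⟩⟩
      show ((d.Ψ₁ (d.x (φ k + 1)) : ℝ) : EReal) + d.Ψ₂ (d.x (φ k + 1)) ≤ _
      rw [hψE, EReal.coe_le_coe_iff]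
      exact hM ⟨_, rfl⟩
  obtain ⟨p, -, θ, hθ, hlim⟩ := hK.tendsto_subseq hKmem
  have hφθ : Tendsto (fun k => φ (θ k)) atTop atTop := hφ.tendsto_atTop.comp hθ.tendsto_atTop
  have hlim' : Tendsto (fun k => d.x (φ (θ k) + 1)) atTop (𝓝 p) := hlim
  have cΨ₁ : Continuous d.Ψ₁ := continuous_iff_continuousAt.2 fun q => (d.gradΨ₁ q).continuousAt
  have cΦ : Continuous d.Φ := continuous_iff_continuousAt.2 fun q => (d.gradΦ q).continuousAt
  have hψsub := hψlim.comp hφθ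
  have hpC : p ∈ d.C := by
    refine (mem_C d).2 ⟨le_antisymm ?_ (d.Ψ₁nonneg p), le_antisymm ?_ (d.Ψ₂nonneg p)⟩
    · refine le_of_tendsto_of_tendsto' ((cΨ₁.tendsto p).comp hlim') hψsub fun k => ?_
      have := EReal.toReal_nonneg (d.Ψ₂nonneg (d.x (φ (θ k) + 1)))
      simp only [Function.comp, hψ]
      linarith
    · refine lsc_le d.properΨ₂.2.2.1 hlim' hψsub fun k => ?_
      rw [← EReal.coe_toReal (algo_fin d (φ (θ k))) (d.properΨ₂.2.1 _), EReal.coe_le_coe_iff]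
      have := d.Ψ₁nonneg (d.x (φ (θ k) + 1))
      simp only [Function.comp, hψ]
      linarith
  have hΦp : Φ₂ p ≤ ((Fs + 0 - d.Φ p : ℝ) : EReal) := by
    have hr : Tendsto (fun k => Fs + 1 / ((θ k : ℝ) + 1) - d.Φ (d.x (φ (θ k) + 1))) atTop
        (𝓝 (Fs + 0 - d.Φ p)) :=
      (tendsto_const_nhds.add (tendsto_one_div_add_atTop_nhds_zero_nat.comp hθ.tendsto_atTop)).sub
        ((cΦ.tendsto p).comp hlim')
    refine lsc_le hΦ₂.2.2.1 hlim' hr fun k => ?_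
    rw [← EReal.coe_toReal (algo_fin₂ d hΦ₂ hA (φ (θ k))) (hΦ₂.2.1 _), EReal.coe_le_coe_iff]
    have := hφF (θ k)
    simp only [hF] at this
    linarith
  have hp2 : Φ₂ p ≠ ⊤ := ne_top_of_le_ne_top (EReal.coe_ne_top _) hΦp
  have hpS : p ∈ d.S := by
    refine mem_S_of_min d hΦ₂ hA hpC hp2 fun y hy hy2 => ?_
    have h1 := S_min d hΦ₂ hA hu hy hy2
    rw [← EReal.coe_toReal hp2 (hΦ₂.2.1 _), EReal.coe_le_coe_iff] at hΦp
    linarith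
  refine ⟨p, hpS, ?_⟩
  obtain ⟨⟨m, hm⟩, -⟩ := fejer_S d hΦ₂ hA hpS
  have hm0 : m = 0 := by
    have t1 := hm.comp ((tendsto_add_atTop_nat 1).comp hφθ)
    have t2 : Tendsto (fun k => ‖d.x (φ (θ k) + 1) - p‖ ^ 2) atTop (𝓝 0) := by
      have := ((tendsto_iff_norm_sub_tendsto_zero.1 hlim').pow 2)
      simpa using this
    exact tendsto_nhds_unique t1 t2
  rw [hm0] at hm
  rw [tendsto_iff_norm_sub_tendsto_zero]
  have := hm.sqrt
  simpa [Real.sqrt_sq] using this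

/-- **Theorem 2.3, case (i).** Under (H₀) with `A = ∂Φ₂`, if `liminf λ_n β_n > 0` and
`Φ + Φ₂` or `Ψ₁ + Ψ₂` is boundedly inf-compact, then `(x_n)` converges weakly to a
point of `S`; moreover convergence is strong if `Ψ₁ + Ψ₂` is boundedly inf-compact. -/
theorem sfbp_weak_subdiff_infCompact (d : SFBP H) (Φ₂ : H → EReal)
    (hΦ₂ : ProperLscConvexE Φ₂) (hA : d.A = ESubdiff Φ₂)
    (hlb : ∃ ε > (0:ℝ), ∀ᶠ n in Filter.atTop, ε ≤ d.lam n * d.beta n)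
    (hic : BddInfCompact (fun p => ((d.Φ p : ℝ) : EReal) + Φ₂ p) ∨
           BddInfCompact (fun p => ((d.Ψ₁ p : ℝ) : EReal) + d.Ψ₂ p)) :
    ∃ p ∈ d.S, WeakConv d.x p ∧
      (BddInfCompact (fun q => ((d.Ψ₁ q : ℝ) : EReal) + d.Ψ₂ q) →
        Filter.Tendsto d.x Filter.atTop (𝓝 p)) := by
  obtain ⟨p, hp, hlim⟩ := strong_conv d Φ₂ hΦ₂ hA hlb hic
  exact ⟨p, hp, fun y => hlim.inner tendsto_const_nhds, fun _ => hlim⟩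
end
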